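/- arXiv:1605.07757 — 2 statements merged into one kernel-verified Lean document; each statement's English description precedes it below -/
import Mathlib

section
/- Let K have characteristic 2 and let k = 1. In A = A^{1,s}(a,c): (i) if s is even then, for every c ∈ K, T₁(A) = [A,A] + span_K({η^t : s/2 < t ≤ s−1} ∪ {βγα}); (ii) if s is odd and c ≠ 0 then T₁(A) = [A,A] + span_K({η^t : (s−1)/2 < t ≤ s−1} ∪ {βγα}); (iii) if s is odd, c = 0 and a = b² for some b ∈ K, then T₁(A) = [A,A] + span_K({α + bη^{(s−1)/2}} ∪ {η^t : (s−1)/2 < t ≤ s−1} ∪ {βγα}); (iv) if s is odd, c = 0 and a is not a square in K, then T₁(A) = [A,A] + span_K({η^t : (s−1)/2 < t ≤ s−1} ∪ {βγα}). -/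
namespace QT

/-- The generators of the free algebra: the two vertex idempotents `e1, e2`,
the loops `al` (α at vertex 1) and `et` (η at vertex 2), and the arrows
`be` (β : 1 → 2) and `ga` (γ : 2 → 1). -/
inductive Gen : Type
  | e1 : Gen
  | e2 : Gen
  | al : Gen
  | be : Gen
  | ga : Gen
  | et : Gen

open Gen

/-- Generators as elements of the free algebra. -/
noncomputable def gen (K : Type) [Field K] (g : Gen) : FreeAlgebra K Gen :=
  FreeAlgebra.ι K g

/-- The defining relations of the algebra `A^{k,s}(a,c)`: the path-algebra
relations for the quiver with two vertices, loops α, η and arrows β, γ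
(paths composed left to right), together with the relations
βη = (αβγ)^{k−1}αβ, ηγ = (γαβ)^{k−1}γα, α² = a(βγα)^{k−1}βγ + c(βγα)^k,
γβ = η^{s−1}, α²β = 0, γα² = 0. -/
inductive Rel (K : Type) [Field K] (k s : ℕ) (a c : K) :
    FreeAlgebra K Gen → FreeAlgebra K Gen → Prop
  | idem1 : Rel K k s a c (gen K e1 * gen K e1) (gen K e1)
  | idem2 : Rel K k s a c (gen K e2 * gen K e2) (gen K e2)
  | orth12 : Rel K k s a c (gen K e1 * gen K e2) 0
  | orth21 : Rel K k s a c (gen K e2 * gen K e1) 0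
  | sum_idem : Rel K k s a c (gen K e1 + gen K e2) 1
  | al_left : Rel K k s a c (gen K e1 * gen K al) (gen K al)
  | al_right : Rel K k s a c (gen K al * gen K e1) (gen K al)
  | be_left : Rel K k s a c (gen K e1 * gen K be) (gen K be)
  | be_right : Rel K k s a c (gen K be * gen K e2) (gen K be)
  | ga_left : Rel K k s a c (gen K e2 * gen K ga) (gen K ga)
  | ga_right : Rel K k s a c (gen K ga * gen K e1) (gen K ga)
  | et_left : Rel K k s a c (gen K e2 * gen K et) (gen K et)
  | et_right : Rel K k s a c (gen K et * gen K e2) (gen K et)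
  | rel_beta_eta : Rel K k s a c (gen K be * gen K et)
      ((gen K al * gen K be * gen K ga) ^ (k - 1) * (gen K al * gen K be))
  | rel_eta_gamma : Rel K k s a c (gen K et * gen K ga)
      ((gen K ga * gen K al * gen K be) ^ (k - 1) * (gen K ga * gen K al))
  | rel_alpha_sq : Rel K k s a c (gen K al * gen K al)
      (a • ((gen K be * gen K ga * gen K al) ^ (k - 1) * (gen K be * gen K ga)) +
        c • (gen K be * gen K ga * gen K al) ^ k)
  | rel_gamma_beta : Rel K k s a c (gen K ga * gen K be) ((gen K et) ^ (s - 1))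
  | rel_alpha_sq_beta : Rel K k s a c (gen K al * gen K al * gen K be) 0
  | rel_gamma_alpha_sq : Rel K k s a c (gen K ga * (gen K al * gen K al)) 0

/-- The algebra `A^{k,s}(a,c)` of quaternion type with two simple modules. -/
abbrev Aa (K : Type) [Field K] (k s : ℕ) (a c : K) : Type :=
  RingQuot (Rel K k s a c)

variable (K : Type) [Field K] (k s : ℕ) (a c : K)

/-- The idempotent e₁ in `A^{k,s}(a,c)`. -/
noncomputable def E1 : Aa K k s a c := RingQuot.mkAlgHom K (Rel K k s a c) (gen K e1)
/-- The idempotent e₂ in `A^{k,s}(a,c)`. -/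
noncomputable def E2 : Aa K k s a c := RingQuot.mkAlgHom K (Rel K k s a c) (gen K e2)
/-- The loop α in `A^{k,s}(a,c)`. -/
noncomputable def Al : Aa K k s a c := RingQuot.mkAlgHom K (Rel K k s a c) (gen K al)
/-- The arrow β in `A^{k,s}(a,c)`. -/
noncomputable def Be : Aa K k s a c := RingQuot.mkAlgHom K (Rel K k s a c) (gen K be)
/-- The arrow γ in `A^{k,s}(a,c)`. -/
noncomputable def Ga : Aa K k s a c := RingQuot.mkAlgHom K (Rel K k s a c) (gen K ga)
/-- The loop η in `A^{k,s}(a,c)`. -/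
noncomputable def Et : Aa K k s a c := RingQuot.mkAlgHom K (Rel K k s a c) (gen K et)

/-- The commutator subspace [A,A]: the K-subspace spanned by all commutators. -/
noncomputable def comm : Submodule K (Aa K k s a c) :=
  Submodule.span K {z : Aa K k s a c | ∃ u v : Aa K k s a c, z = u * v - v * u}

/-- Index type for the basis B = B₁ ∪ B₂ ∪ B₃ ∪ B₄ of `A^{k,s}(a,c)`. -/
abbrev BIdx (k s : ℕ) : Type :=
  ((Fin k ⊕ Fin k) ⊕ (Fin (k - 1) ⊕ Fin (k + 1))) ⊕
    ((Fin (s + 1) ⊕ Fin (k - 1)) ⊕ ((Fin k ⊕ Fin k) ⊕ (Fin k ⊕ Fin k)))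

/-- The family of elements of `A^{k,s}(a,c)` given by
B₁ = {α(βγα)^n, (βγα)^nβγ : 0 ≤ n ≤ k−1} ∪ {(βγα)^m : 1 ≤ m ≤ k−1} ∪ {(αβγ)^ℓ : 0 ≤ ℓ ≤ k},
B₂ = {η^t : 0 ≤ t ≤ s} ∪ {(γαβ)^m : 1 ≤ m ≤ k−1},
B₃ = {(βγα)^nβ, α(βγα)^nβ : 0 ≤ n ≤ k−1},
B₄ = {(γαβ)^nγ, (γαβ)^nγα : 0 ≤ n ≤ k−1}. -/
noncomputable def bVec : BIdx k s → Aa K k s a c := fun i =>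
  let α := Al K k s a c
  let β := Be K k s a c
  let γ := Ga K k s a c
  let η := Et K k s a c
  match i with
  | .inl (.inl (.inl n)) => α * (β * γ * α) ^ (n : ℕ)
  | .inl (.inl (.inr n)) => (β * γ * α) ^ (n : ℕ) * (β * γ)
  | .inl (.inr (.inl m)) => (β * γ * α) ^ ((m : ℕ) + 1)
  | .inl (.inr (.inr l)) => (α * β * γ) ^ (l : ℕ)
  | .inr (.inl (.inl t)) => η ^ (t : ℕ)
  | .inr (.inl (.inr m)) => (γ * α * β) ^ ((m : ℕ) + 1)
  | .inr (.inr (.inl (.inl n))) => (β * γ * α) ^ (n : ℕ) * β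
  | .inr (.inr (.inl (.inr n))) => α * (β * γ * α) ^ (n : ℕ) * β
  | .inr (.inr (.inr (.inl n))) => (γ * α * β) ^ (n : ℕ) * γ
  | .inr (.inr (.inr (.inr n))) => (γ * α * β) ^ (n : ℕ) * (γ * α)

/-- `ψ` is the linear form on `A^{k,s}(a,c)` sending η^s and (αβγ)^k to 1 and every
other element of the basis B to 0. -/
noncomputable def IsPsi (ψ : Aa K k s a c →ₗ[K] K) : Prop :=
  ψ ((Et K k s a c) ^ s) = 1 ∧
  ψ ((Al K k s a c * Be K k s a c * Ga K k s a c) ^ k) = 1 ∧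
  ∀ i : BIdx k s, bVec K k s a c i ≠ (Et K k s a c) ^ s →
    bVec K k s a c i ≠ (Al K k s a c * Be K k s a c * Ga K k s a c) ^ k →
    ψ (bVec K k s a c i) = 0

/-- The set T₁(A) = {x ∈ A : x² ∈ [A,A]} (characteristic 2). -/
noncomputable def T1 : Set (Aa K k s a c) :=
  {z : Aa K k s a c | z ^ 2 ∈ comm K k s a c}

/-- The orthogonal space T₁(A)^⊥ of T₁(A) with respect to the symmetrising form
⟨u,v⟩ = ψ(uv): the space of all z with ψ(z·m) = 0 for all m ∈ T₁(A). -/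
noncomputable def perp (ψ : Aa K k s a c →ₗ[K] K) : Submodule K (Aa K k s a c) :=
  ⨅ m ∈ T1 K k s a c, LinearMap.ker (ψ ∘ₗ LinearMap.mulRight K m)

end QT

namespace QT

variable (K : Type) [Field K] (k s : ℕ) (a c : K)

/-- The set of powers η^t with n < 2t and t ≤ s−1 (i.e. n/2 < t ≤ s−1). -/
noncomputable def etaAbove (n : ℕ) : Set (Aa K k s a c) :=
  {z : Aa K k s a c | ∃ t : ℕ, n < 2 * t ∧ t ≤ s - 1 ∧ z = (Et K k s a c) ^ t}

/-- The set of powers (βγα)^m with n < 2m and m ≤ k (i.e. n/2 < m ≤ k). -/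
noncomputable def cycAbove (n : ℕ) : Set (Aa K k s a c) :=
  {z : Aa K k s a c | ∃ m : ℕ, n < 2 * m ∧ m ≤ k ∧
    z = (Be K k s a c * Ga K k s a c * Al K k s a c) ^ m}

end QT

namespace QTaux

set_option linter.unusedSimpArgs false

/-- commutator subspace of a general algebra -/
def cm (K A : Type) [Field K] [Ring A] [Algebra K A] : Submodule K A :=
  Submodule.span K {z : A | ∃ u v : A, z = u * v - v * u}

/-- relations for k = 1 -/
structure QR {K A : Type} [Field K] [Ring A] [Algebra K A] (s : ℕ) (a c : K)
    (e1 e2 al be ga et : A) : Prop where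
  i1 : e1 * e1 = e1
  i2 : e2 * e2 = e2
  o12 : e1 * e2 = 0
  o21 : e2 * e1 = 0
  su : e1 + e2 = 1
  all : e1 * al = al
  alr : al * e1 = al
  bel : e1 * be = be
  ber : be * e2 = be
  gal : e2 * ga = ga
  gar : ga * e1 = ga
  etl : e2 * et = et
  etr : et * e2 = et
  r1 : be * et = al * be
  r2 : et * ga = ga * al
  r3 : al * al = a • (be * ga) + c • (be * ga * al)
  r4 : ga * be = et ^ (s - 1)
  r5 : al * al * be = 0
  r6 : ga * (al * al) = 0

section
variable {K A : Type} [Field K] [Ring A] [Algebra K A] {s : ℕ} {a c : K}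
  {e1 e2 al be ga et : A}

lemma cm_comm (x y : A) : x * y - y * x ∈ cm K A :=
  Submodule.subset_span ⟨x, y, rfl⟩

namespace QR

lemma mul0 {x p y q : A} (hx : x * p = x) (hy : q * y = y) (h : p * q = 0) : x * y = 0 := by
  rw [← hx, ← hy, mul_assoc, ← mul_assoc p, h, zero_mul, mul_zero]

variable (h : QR s a c e1 e2 al be ga et)
include h

lemma e2al : e2 * al = 0 := mul0 h.i2 h.all h.o21
lemma ale2 : al * e2 = 0 := mul0 h.alr h.i2 h.o12
lemma e2be : e2 * be = 0 := mul0 h.i2 h.bel h.o21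
lemma bee1 : be * e1 = 0 := mul0 h.ber h.i1 h.o21
lemma e1ga : e1 * ga = 0 := mul0 h.i1 h.gal h.o12
lemma gae2 : ga * e2 = 0 := mul0 h.gar h.i2 h.o12
lemma e1et : e1 * et = 0 := mul0 h.i1 h.etl h.o12
lemma ete1 : et * e1 = 0 := mul0 h.etr h.i1 h.o21
lemma alet : al * et = 0 := mul0 h.alr h.etl h.o12
lemma etal : et * al = 0 := mul0 h.etr h.all h.o21
lemma alga : al * ga = 0 := mul0 h.alr h.gal h.o12
lemma beal : be * al = 0 := mul0 h.ber h.all h.o21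
lemma bebe : be * be = 0 := mul0 h.ber h.bel h.o21
lemma gaga : ga * ga = 0 := mul0 h.gar h.gal h.o12
lemma etbe : et * be = 0 := mul0 h.etr h.bel h.o21
lemma gaet : ga * et = 0 := mul0 h.gar h.etl h.o12

lemma e2pow (t : ℕ) : e2 * et ^ t = et ^ t * e2 := by
  have : Commute e2 et := by
    show e2 * et = et * e2
    rw [h.etl, h.etr]
  exact this.pow_right t

lemma e2pow' {t : ℕ} (ht : 1 ≤ t) : e2 * et ^ t = et ^ t := by
  obtain ⟨n, rfl⟩ := Nat.exists_eq_add_of_le' ht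
  rw [pow_succ', ← mul_assoc, h.etl]

lemma abg : al * be * ga = be * ga * al := by
  rw [← h.r1, mul_assoc, h.r2, mul_assoc]

lemma beetn (hs : 3 ≤ s) : be * et ^ (s - 1) = 0 := by
  obtain ⟨n, rfl⟩ := Nat.exists_eq_add_of_le' hs
  have : n + 3 - 1 = 2 + n := by omega
  rw [this, pow_add, ← mul_assoc, pow_two, ← mul_assoc, h.r1, mul_assoc al, h.r1, ← mul_assoc,
    h.r5, zero_mul]

lemma etnga (hs : 3 ≤ s) : et ^ (s - 1) * ga = 0 := by
  obtain ⟨n, rfl⟩ := Nat.exists_eq_add_of_le' hs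
  have : n + 3 - 1 = n + 2 := by omega
  rw [this, pow_add, mul_assoc, pow_two, mul_assoc, h.r2, ← mul_assoc et, h.r2, mul_assoc ga,
    h.r6, mul_zero]

lemma bgb (hs : 3 ≤ s) : be * ga * be = 0 := by
  rw [mul_assoc, h.r4, h.beetn hs]

lemma gbg (hs : 3 ≤ s) : ga * be * ga = 0 := by
  rw [h.r4, h.etnga hs]

lemma gab (hs : 3 ≤ s) : ga * al * be = et ^ s := by
  rw [mul_assoc, ← h.r1, ← mul_assoc, h.r4, ← pow_succ]
  congr 1; omega

lemma eta0 {t : ℕ} (hs : 3 ≤ s) (ht : s + 1 ≤ t) : et ^ t = 0 := by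
  have h1 : et ^ (s + 1) = 0 := by
    rw [pow_succ', ← h.gab hs, ← mul_assoc, ← mul_assoc, h.r2, mul_assoc ga, h.r6, zero_mul]
  exact pow_eq_zero_of_le ht h1

lemma alabg : al * (be * ga * al) = 0 := by
  rw [← mul_assoc, ← mul_assoc, h.abg, mul_assoc, mul_assoc be, h.r6, mul_zero]

lemma abgal : be * ga * al * al = 0 := by
  rw [mul_assoc, mul_assoc be, h.r6, mul_zero]

lemma bega0 : (be * ga * al) ^ 2 = 0 := by
  rw [pow_two, mul_assoc (be * ga), h.alabg, mul_zero]

lemma bpow (n : ℕ) : be * et ^ (n + 2) = 0 := by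
  rw [add_comm, pow_add, ← mul_assoc, pow_two, ← mul_assoc, h.r1, mul_assoc al, h.r1, ← mul_assoc,
    h.r5, zero_mul]
lemma powg (n : ℕ) : et ^ (n + 2) * ga = 0 := by
  rw [pow_add, mul_assoc, pow_two, mul_assoc, h.r2, ← mul_assoc et, h.r2, mul_assoc ga,
    h.r6, mul_zero]
lemma e1p (n : ℕ) : e1 * et ^ (n + 1) = 0 := by
  rw [pow_succ', ← mul_assoc, h.e1et, zero_mul]
lemma pe1 (n : ℕ) : et ^ (n + 1) * e1 = 0 := by
  rw [pow_succ, mul_assoc, h.ete1, mul_zero]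
lemma alp (n : ℕ) : al * et ^ (n + 1) = 0 := by
  rw [pow_succ', ← mul_assoc, h.alet, zero_mul]
lemma pal (n : ℕ) : et ^ (n + 1) * al = 0 := by
  rw [pow_succ, mul_assoc, h.etal, mul_zero]
lemma gap (n : ℕ) : ga * et ^ (n + 1) = 0 := by
  rw [pow_succ', ← mul_assoc, h.gaet, zero_mul]
lemma pbe (n : ℕ) : et ^ (n + 1) * be = 0 := by
  rw [pow_succ, mul_assoc, h.etbe, mul_zero]

end QR

lemma ra {x y w : A} (h : x * y = w) (z : A) : x * (y * z) = w * z := by rw [← mul_assoc, h]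

/-- the spanning set -/
inductive Bs (e1 e2 al be ga et : A) : A → Prop
  | b1 : Bs e1 e2 al be ga et e1
  | b2 : Bs e1 e2 al be ga et al
  | b3 : Bs e1 e2 al be ga et (be * ga)
  | b4 : Bs e1 e2 al be ga et (be * ga * al)
  | b5 : Bs e1 e2 al be ga et be
  | b6 : Bs e1 e2 al be ga et (al * be)
  | b7 : Bs e1 e2 al be ga et ga
  | b8 : Bs e1 e2 al be ga et (ga * al)
  | b9 : Bs e1 e2 al be ga et e2
  | b10 : Bs e1 e2 al be ga et et
  | b11 (n : ℕ) : Bs e1 e2 al be ga et (et ^ (n + 2))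

/-- generators -/
inductive Gs (e1 al be ga et : A) : A → Prop
  | g1 : Gs e1 al be ga et e1
  | g2 : Gs e1 al be ga et al
  | g3 : Gs e1 al be ga et be
  | g4 : Gs e1 al be ga et ga
  | g5 : Gs e1 al be ga et et

lemma right_closed (h : QR s a c e1 e2 al be ga et) (hs : 3 ≤ s) (x g : A)
    (hx : Bs e1 e2 al be ga et x) (hg : Gs e1 al be ga et g) :
    x * g ∈ Submodule.span K {z | Bs e1 e2 al be ga et z} := by
  have mem : ∀ z, Bs e1 e2 al be ga et z → z ∈ Submodule.span K {z | Bs e1 e2 al be ga et z} :=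
    fun z hz => Submodule.subset_span hz
  have r3m : al * al ∈ Submodule.span K {z | Bs e1 e2 al be ga et z} := by
    rw [h.r3]
    exact add_mem (Submodule.smul_mem _ _ (mem _ .b3)) (Submodule.smul_mem _ _ (mem _ .b4))
  obtain ⟨m, rfl⟩ := Nat.exists_eq_add_of_le' hs
  have r4' : ga * be = et ^ (m + 2) := h.r4
  have gab' : ga * (al * be) = et ^ (m + 1 + 2) := by rw [← mul_assoc]; exact h.gab hs
  have abg' := h.abg
  have r5' := h.r5
  have bg : be * (ga * (al * be)) = 0 := by rw [gab', h.bpow]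
  have bga := mem _ .b4
  rw [mul_assoc] at abg' r5' bga
  rw [mul_assoc] at abg'
  have ee : et * et = et ^ (0 + 2) := by rw [pow_two]
  have epe : ∀ n, et ^ (n + 2) * et = et ^ (n + 1 + 2) := fun n => by rw [← pow_succ]
  cases hx <;> cases hg <;>
  simp only [mul_assoc, h.i1, h.o21, h.all, h.alr, h.bel, h.gar, h.etl, h.etr, h.gal, h.e2be,
    h.e2al, h.bee1, h.e1ga, h.e1et, h.ete1, h.alet, h.etal, h.alga, h.beal, h.bebe, h.gaga, h.etbe,
    h.gaet, h.r1, h.r2, r4', r5', h.r6, gab', bg, abg', ee, epe, ra h.r1, h.powg, h.pe1, h.pal,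
    h.pbe, h.bpow, mul_zero, zero_mul, zero_mem, r3m, mem _ .b1,
    mem _ .b2, mem _ .b3, bga, mem _ .b5, mem _ .b6, mem _ .b7, mem _ .b8, mem _ .b9, mem _ .b10,
    mem _ (.b11 _)]

lemma span_top (h : QR s a c e1 e2 al be ga et) (hs : 3 ≤ s)
    (hadj : Algebra.adjoin K {z | Gs e1 al be ga et z} = ⊤) (x : A) :
    x ∈ Submodule.span K {z | Bs e1 e2 al be ga et z} := by
  have key : ∀ y : A, ∀ x ∈ Submodule.span K {z | Bs e1 e2 al be ga et z},
      x * y ∈ Submodule.span K {z | Bs e1 e2 al be ga et z} := by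
    intro y
    have hy : y ∈ Algebra.adjoin K {z | Gs e1 al be ga et z} := by rw [hadj]; trivial
    induction hy using Algebra.adjoin_induction with
    | mem g hg =>
      intro x hx
      induction hx using Submodule.span_induction with
      | mem x hx => exact right_closed h hs x g hx hg
      | zero => simp
      | add x y _ _ hx hy => rw [add_mul]; exact add_mem hx hy
      | smul r x _ hx => rw [smul_mul_assoc]; exact Submodule.smul_mem _ _ hx
    | algebraMap r =>
      intro x hx
      rw [← Algebra.commutes, ← Algebra.smul_def]; exact Submodule.smul_mem _ _ hx
    | add y z _ _ hy hz => intro x hx; rw [mul_add]; exact add_mem (hy x hx) (hz x hx)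
    | mul y z _ _ hy hz => intro x hx; rw [← mul_assoc]; exact hz _ (hy x hx)
  have h1 : (1 : A) ∈ Submodule.span K {z | Bs e1 e2 al be ga et z} := by
    rw [← h.su]
    exact add_mem (Submodule.subset_span .b1) (Submodule.subset_span .b9)
  simpa using key x 1 h1

lemma trace_gen (h : QR s a c e1 e2 al be ga et) (hs : 3 ≤ s) (f : A →ₗ[K] K)
    (f1 : f be = 0) (f2 : f (al * be) = 0) (f3 : f ga = 0) (f4 : f (ga * al) = 0)
    (f5 : f (be * ga) = f (et ^ (s - 1))) (f6 : f (be * ga * al) = f (et ^ s))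
    (x g : A) (hx : Bs e1 e2 al be ga et x) (hg : Gs e1 al be ga et g) :
    f (x * g) = f (g * x) := by
  obtain ⟨m, rfl⟩ := Nat.exists_eq_add_of_le' hs
  have r4' : ga * be = et ^ (m + 2) := h.r4
  have gab' : ga * (al * be) = et ^ (m + 3) := by rw [← mul_assoc]; exact h.gab hs
  have abg' := h.abg
  have r5' := h.r5
  have bg : be * (ga * (al * be)) = 0 := by rw [gab', h.bpow]
  rw [mul_assoc] at abg' r5'
  rw [mul_assoc] at abg'
  have f5' : f (be * ga) = f (et ^ (m + 2)) := f5
  rw [mul_assoc] at f6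
  have aa : al * (be * (ga * al)) = 0 := by rw [← mul_assoc be]; exact h.alabg
  have epe : ∀ n, et ^ (n + 2) * et = et * et ^ (n + 2) := fun n => by rw [← pow_succ, ← pow_succ']
  cases hx <;> cases hg <;>
  simp only [mul_assoc, h.i1, h.o12, h.o21, h.all, h.alr, h.bel, h.ber, h.gar, h.etl, h.etr, h.gal,
    h.e2be, h.e2al, h.ale2, h.gae2, ra h.bel,
    ra h.e1ga, ra h.all, ra h.bebe, ra h.gaga, ra h.beal, ra h.alga, ra h.etbe, ra h.etal, ra (h.powg _), ra r4',
    h.bee1, h.e1ga, h.e1et, h.ete1, h.alet, h.etal, h.alga, h.beal, h.bebe, h.gaga, h.etbe,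
    h.gaet, h.r1, h.r2, r4', r5', h.r6, gab', bg, abg', epe, ra h.r1, ra h.r2, h.powg, h.pe1, h.pal,
    h.pbe, h.bpow, h.alp, h.e1p, h.gap, mul_zero, zero_mul, map_zero, f1, f2, f3, f4, f5', f6, aa]

lemma trace_all (h : QR s a c e1 e2 al be ga et) (hs : 3 ≤ s)
    (hadj : Algebra.adjoin K {z | Gs e1 al be ga et z} = ⊤) (f : A →ₗ[K] K)
    (f1 : f be = 0) (f2 : f (al * be) = 0) (f3 : f ga = 0) (f4 : f (ga * al) = 0)
    (f5 : f (be * ga) = f (et ^ (s - 1))) (f6 : f (be * ga * al) = f (et ^ s))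
    (x y : A) : f (x * y) = f (y * x) := by
  have hy : y ∈ Algebra.adjoin K {z | Gs e1 al be ga et z} := by rw [hadj]; trivial
  induction hy using Algebra.adjoin_induction generalizing x with
  | mem g hg =>
    have hx := span_top h hs hadj x
    induction hx using Submodule.span_induction with
    | mem x hx => exact trace_gen h hs f f1 f2 f3 f4 f5 f6 x g hx hg
    | zero => simp
    | add x y _ _ hx hy => rw [add_mul, mul_add, map_add, map_add, hx, hy]
    | smul r x _ hx => rw [smul_mul_assoc, mul_smul_comm, map_smul, map_smul, hx]
  | algebraMap r => rw [Algebra.commutes]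
  | add y z _ _ hy hz => rw [mul_add, add_mul, map_add, map_add, hy, hz]
  | mul y z _ _ hy hz => rw [← mul_assoc, hz, ← mul_assoc, hy, mul_assoc]

lemma trace_cm (f : A →ₗ[K] K) (hf : ∀ x y, f (x * y) = f (y * x)) (x : A) (hx : x ∈ cm K A) :
    f x = 0 := by
  induction hx using Submodule.span_induction with
  | mem x hx => obtain ⟨u, v, rfl⟩ := hx; rw [map_sub, hf, sub_self]
  | zero => simp
  | add x y _ _ hx hy => rw [map_add, hx, hy, add_zero]
  | smul r x _ hx => rw [map_smul, hx, smul_zero]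

lemma add_self0 [CharP K 2] (x : A) : x + x = 0 := by
  rw [← two_smul K x, CharTwo.two_eq_zero, zero_smul]

lemma neg_self0 [CharP K 2] (x : A) : -x = x := by
  rw [neg_eq_iff_add_eq_zero]; exact add_self0 (K := K) x

lemma sq_add_cm [CharP K 2] (x y : A) : (x + y) ^ 2 - (x ^ 2 + y ^ 2) ∈ cm K A := by
  have : (x + y) ^ 2 - (x ^ 2 + y ^ 2) = (x * y - y * x) + (y * x + y * x) := by noncomm_ring
  rw [this, add_self0 (K := K), add_zero]
  exact cm_comm x y

/-- T1 as a submodule -/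
def T1s (K A : Type) [Field K] [CharP K 2] [Ring A] [Algebra K A] : Submodule K A where
  carrier := {z | z ^ 2 ∈ cm K A}
  zero_mem' := by simp
  add_mem' := by
    intro x y hx hy
    have := add_mem (sq_add_cm (K := K) x y) (add_mem hx hy)
    simpa using this
  smul_mem' := by
    intro r x hx
    show (r • x) ^ 2 ∈ cm K A
    rw [smul_pow]
    exact Submodule.smul_mem _ _ hx

lemma mem_T1s [CharP K 2] (x : A) : x ∈ T1s K A ↔ x ^ 2 ∈ cm K A := Iff.rfl

lemma cm_le_T1s [CharP K 2] : cm K A ≤ T1s K A := by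
  refine Submodule.span_le.2 ?_
  rintro _ ⟨u, v, rfl⟩
  show _ ^ 2 ∈ cm K A
  have : (u * v - v * u) ^ 2 = (u * (v * u * v) - (v * u * v) * u) + (v * u * v * u + v * u * v * u)
    - ((u * (v * v * u) - (v * v * u) * u) - ((v * (v * u * u) - (v * u * u) * v)))
    - (v * v * u * u + v * v * u * u) := by noncomm_ring
  rw [this, add_self0 (K := K), add_self0 (K := K), add_zero, sub_zero]
  exact sub_mem (cm_comm _ _) (sub_mem (cm_comm _ _) (cm_comm _ _))

lemma f_sq [CharP K 2] (f : A →ₗ[K] K) (hf : ∀ x y, f (x * y) = f (y * x)) (x y : A) :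
    f ((x + y) ^ 2) = f (x ^ 2) + f (y ^ 2) := by
  have := trace_cm f hf _ (sq_add_cm (K := K) x y)
  rw [map_sub, map_add] at this
  exact sub_eq_zero.1 this

lemma f_sq_sum [CharP K 2] (f : A →ₗ[K] K) (hf : ∀ x y, f (x * y) = f (y * x)) (n : Finset ℕ)
    (x : ℕ → A) : f ((∑ i ∈ n, x i) ^ 2) = ∑ i ∈ n, f (x i ^ 2) := by
  classical
  induction n using Finset.induction_on with
  | empty => simp
  | insert i n hi ih => rw [Finset.sum_insert hi, Finset.sum_insert hi, f_sq f hf, ih]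

/-- normal form -/
def nf (s : ℕ) (e1 e2 al et : A) (p u : K) (v : ℕ → K) : A :=
  p • e1 + u • al + ∑ t ∈ Finset.range (s / 2 + 1), v t • (e2 * et ^ t)

lemma nf_single (s : ℕ) (e1 e2 al et : A) (n : ℕ) (hn : n ≤ s / 2) :
    nf s e1 e2 al et (0 : K) 0 (Pi.single n 1) = e2 * et ^ n := by
  unfold nf
  rw [Finset.sum_eq_single n]
  · simp
  · intro b _ hb; rw [Pi.single_eq_of_ne hb, zero_smul]
  · intro hh; exact absurd (Finset.mem_range.2 (by omega)) hh

lemma decomp (h : QR s a c e1 e2 al be ga et) (hs : 3 ≤ s)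
    (hadj : Algebra.adjoin K {z | Gs e1 al be ga et z} = ⊤)
    (D : Submodule K A) (hcm : cm K A ≤ D) (hb : be * ga * al ∈ D)
    (hη : ∀ t, s < 2 * t → t ≤ s - 1 → et ^ t ∈ D) (x : A) :
    ∃ (p u : K) (v : ℕ → K), x - nf s e1 e2 al et p u v ∈ D := by
  have htriv : ∀ x ∈ D, ∃ (p u : K) (v : ℕ → K), x - nf s e1 e2 al et p u v ∈ D := by
    intro x hx
    refine ⟨0, 0, 0, ?_⟩
    simpa [nf] using hx
  have hpow : ∀ n, ∃ (p u : K) (v : ℕ → K), e2 * et ^ n - nf s e1 e2 al et p u v ∈ D := by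
    intro n
    by_cases h1 : n ≤ s / 2
    · refine ⟨0, 0, Pi.single n 1, ?_⟩
      rw [nf_single _ _ _ _ _ _ h1, sub_self]; exact zero_mem _
    · apply htriv
      rw [h.e2pow' (by omega)]
      by_cases h2 : n ≤ s - 1
      · exact hη n (by omega) h2
      by_cases h3 : n = s
      · subst h3
        rw [← h.gab hs]
        have := hcm (cm_comm (K := K) ga (al * be))
        rw [h.abg, ← mul_assoc] at this
        have := add_mem this hb
        simpa using this
      · rw [h.eta0 hs (by omega)]; exact zero_mem _
  have hoff : ∀ x y : A, y * x = 0 → x * y ∈ D := by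
    intro x y hxy
    have := hcm (cm_comm (K := K) x y)
    rwa [hxy, sub_zero] at this
  have hx := span_top h hs hadj x
  induction hx using Submodule.span_induction with
  | mem x hx =>
    cases hx with
    | b1 => exact ⟨1, 0, 0, by simp [nf]⟩
    | b2 => exact ⟨0, 1, 0, by simp [nf]⟩
    | b3 =>
      obtain ⟨p, u, v, h1⟩ := hpow (s - 1)
      refine ⟨p, u, v, ?_⟩
      have := add_mem h1 (hcm (cm_comm (K := K) be ga))
      rw [h.e2pow' (by omega), h.r4] at this
      convert this using 1
      abel
    | b4 => exact htriv _ hb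
    | b5 => exact htriv _ (by rw [← h.ber]; exact hoff _ _ h.e2be)
    | b6 => exact htriv _ (hoff _ _ h.beal)
    | b7 => exact htriv _ (by rw [← h.gar]; exact hoff _ _ h.e1ga)
    | b8 => exact htriv _ (hoff _ _ h.alga)
    | b9 => simpa using hpow 0
    | b10 => simpa [h.etl] using hpow 1
    | b11 n => simpa [h.e2pow'] using hpow (n + 2)
  | zero => exact htriv 0 (zero_mem _)
  | add x y _ _ hx hy =>
    obtain ⟨p, u, v, h1⟩ := hx
    obtain ⟨p', u', v', h2⟩ := hy
    refine ⟨p + p', u + u', v + v', ?_⟩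
    convert add_mem h1 h2 using 1
    simp only [nf, Pi.add_apply, add_smul, Finset.sum_add_distrib]
    abel
  | smul r x _ hx =>
    obtain ⟨p, u, v, h1⟩ := hx
    refine ⟨r * p, r * u, fun t => r * v t, ?_⟩
    convert Submodule.smul_mem _ r h1 using 1
    simp only [nf, mul_smul, smul_sub, smul_add, Finset.smul_sum]

/-- hypotheses on the trace functionals -/
structure FH (s : ℕ) (e1 e2 al be ga et : A) (j : ℕ) (f : A →ₗ[K] K) : Prop where
  f0 : f e1 = 0
  f1 : f be = 0
  f2 : f (al * be) = 0
  f3 : f ga = 0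
  f4 : f (ga * al) = 0
  f5 : f (be * ga) = if j = s - 1 then 1 else 0
  f6 : f (be * ga * al) = if j = s then 1 else 0
  f7 : ∀ t ≤ s, f (e2 * et ^ t) = if t = j then 1 else 0

lemma key [CharP K 2] (h : QR s a c e1 e2 al be ga et) (hs : 3 ≤ s)
    (hadj : Algebra.adjoin K {z | Gs e1 al be ga et z} = ⊤)
    (P : A →ₐ[K] K) (P1 : P e1 = 1) (P2 : P e2 = 0) (P3 : P al = 0)
    (hF : ∀ j ≤ s, ∃ f : A →ₗ[K] K, FH s e1 e2 al be ga et j f)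
    (G : Set A) (hG : ∀ x ∈ G, x ^ 2 ∈ cm K A) (hb : be * ga * al ∈ G)
    (hη : ∀ t, s < 2 * t → t ≤ s - 1 → et ^ t ∈ G)
    (hfin : ∀ (u : K) (v : ℕ → K),
      (∀ j ≤ s, u ^ 2 * ((if j = s - 1 then a else 0) + (if j = s then c else 0)) +
        ∑ t ∈ Finset.range (s / 2 + 1), (if 2 * t = j then v t ^ 2 else 0) = 0) →
      nf s e1 e2 al et 0 u v ∈ cm K A ⊔ Submodule.span K G) :
    {z : A | z ^ 2 ∈ cm K A} = ↑(cm K A ⊔ Submodule.span K G) := by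
  have hle : cm K A ⊔ Submodule.span K G ≤ T1s K A :=
    sup_le cm_le_T1s (Submodule.span_le.2 hG)
  apply Set.Subset.antisymm _ hle
  intro x hx
  have hx : x ∈ T1s K A := hx
  obtain ⟨p, u, v, hd⟩ := decomp h hs hadj (cm K A ⊔ Submodule.span K G) le_sup_left
    (le_sup_right (a := cm K A) (Submodule.subset_span hb))
    (fun t h1 h2 => le_sup_right (a := cm K A) (Submodule.subset_span (hη t h1 h2))) x
  have hn : nf s e1 e2 al et p u v ∈ T1s K A := by
    have := sub_mem hx (hle hd)
    simpa using this
  have hn : nf s e1 e2 al et p u v ^ 2 ∈ cm K A := hn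
  have hfs : ∀ f : A →ₗ[K] K, (∀ x y, f (x * y) = f (y * x)) →
      p ^ 2 * f e1 + u ^ 2 * f (al * al) +
        ∑ t ∈ Finset.range (s / 2 + 1), v t ^ 2 * f (e2 * et ^ (2 * t)) = 0 := by
    intro f hf
    have := trace_cm f hf _ hn
    rw [nf, f_sq f hf, f_sq f hf, f_sq_sum f hf] at this
    have hsq : ∀ t, (e2 * et ^ t) ^ 2 = e2 * et ^ (2 * t) := by
      intro t
      rw [pow_two]
      nth_rewrite 2 [h.e2pow]
      rw [mul_assoc, ← mul_assoc (et ^ t), ← pow_add, ← two_mul, ← h.e2pow, ← mul_assoc, h.i2]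
    simpa only [smul_pow, map_smul, smul_eq_mul, hsq, pow_two e1, h.i1, pow_two al] using this
  have hp : p = 0 := by
    have := hfs P.toLinearMap (fun x y => by simp [mul_comm])
    simpa [P1, P2, P3] using this
  subst hp
  have := hfin u v (by
    intro j hj
    obtain ⟨f, hf⟩ := hF j hj
    have e1' : f (et ^ (s - 1)) = if j = s - 1 then 1 else 0 := by
      rw [← h.e2pow' (by omega), hf.f7 _ (by omega)]
      simp only [eq_comm]
    have e2' : f (et ^ s) = if j = s then 1 else 0 := by
      rw [← h.e2pow' (by omega), hf.f7 _ (by omega)]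
      simp only [eq_comm]
    have := hfs f (trace_all h hs hadj f hf.f1 hf.f2 hf.f3 hf.f4 (hf.f5.trans e1'.symm)
      (hf.f6.trans e2'.symm))
    rw [h.r3, map_add, map_smul, map_smul, hf.f5, hf.f6, hf.f0] at this
    refine Eq.trans ?_ this
    simp only [smul_eq_mul, mul_ite, mul_one, mul_zero, zero_add]
    congr 1
    apply Finset.sum_congr rfl
    intro t ht
    rw [hf.f7 _ (by have := Finset.mem_range.1 ht; omega)]
    simp)
  have := add_mem hd this
  simpa using this

end

section rep
variable {K : Type} [Field K]

/-- first representation, on the projective at vertex 1 -/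
def R1 (a c : K) : QT.Gen → Module.End K (Fin 6 → K)
  | .e1 => { toFun := fun x => ![x 0, x 1, x 2, x 3, 0, 0]
             map_add' := by intro x y; ext i; fin_cases i <;> simp
             map_smul' := by intro x y; ext i; fin_cases i <;> simp }
  | .e2 => { toFun := fun x => ![0, 0, 0, 0, x 4, x 5]
             map_add' := by intro x y; ext i; fin_cases i <;> simp
             map_smul' := by intro x y; ext i; fin_cases i <;> simp }
  | .al => { toFun := fun x => ![0, x 0, a * x 1, c * x 1 + x 2, 0, 0]
             map_add' := by intro x y; ext i; fin_cases i <;> simp <;> ring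
             map_smul' := by intro x y; ext i; fin_cases i <;> simp <;> ring }
  | .be => { toFun := fun x => ![0, 0, x 4, x 5, 0, 0]
             map_add' := by intro x y; ext i; fin_cases i <;> simp
             map_smul' := by intro x y; ext i; fin_cases i <;> simp }
  | .ga => { toFun := fun x => ![0, 0, 0, 0, x 0, x 1]
             map_add' := by intro x y; ext i; fin_cases i <;> simp
             map_smul' := by intro x y; ext i; fin_cases i <;> simp }
  | .et => { toFun := fun x => ![0, 0, 0, 0, 0, x 4]
             map_add' := by intro x y; ext i; fin_cases i <;> simp
             map_smul' := by intro x y; ext i; fin_cases i <;> simp }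

/-- second representation, on the projective at vertex 2 -/
def R2 (s : ℕ) : QT.Gen → Module.End K (K × K × (ℕ → K))
  | .e1 => { toFun := fun x => (x.1, x.2.1, 0)
             map_add' := by intro x y; simp
             map_smul' := by intro x y; simp }
  | .e2 => { toFun := fun x => (0, 0, x.2.2)
             map_add' := by intro x y; simp
             map_smul' := by intro x y; simp }
  | .al => { toFun := fun x => (0, x.1, 0)
             map_add' := by intro x y; simp
             map_smul' := by intro x y; simp }
  | .be => { toFun := fun x => (x.2.2 0, x.2.2 1, 0)
             map_add' := by intro x y; simp
             map_smul' := by intro x y; simp }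
  | .ga => { toFun := fun x => (0, 0, fun n => if n = s - 1 then x.1 else if n = s then x.2.1 else 0)
             map_add' := by
               intro x y; simp; ext n; simp; split_ifs <;> simp
             map_smul' := by intro x y; simp; ext n; simp }
  | .et => { toFun := fun x => (0, 0, fun n => if 1 ≤ n ∧ n ≤ s then x.2.2 (n - 1) else 0)
             map_add' := by
               intro x y; simp; ext n; simp; split_ifs <;> simp
             map_smul' := by intro x y; simp; ext n; simp }

/-- the one-dimensional representation at vertex 1 -/
def R0 : QT.Gen → K
  | .e1 => 1
  | _ => 0

lemma R1et (a c : K) (t : ℕ) (ht : 2 ≤ t) : R1 a c .et ^ t = 0 := by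
  apply pow_eq_zero_of_le ht
  rw [pow_two]
  apply LinearMap.ext; intro x
  ext i
  fin_cases i <;> simp [R1]

lemma R2et (s t : ℕ) (ht : 1 ≤ t) (x : K × K × (ℕ → K)) :
    (R2 s .et ^ t : Module.End K (K × K × (ℕ → K))) x =
      (0, 0, fun n => if t ≤ n ∧ n ≤ s then x.2.2 (n - t) else 0) := by
  induction t, ht using Nat.le_induction with
  | base => rw [pow_one]; rfl
  | succ t ht ih =>
    rw [pow_succ', Module.End.mul_apply, ih]
    simp only [R2, LinearMap.coe_mk, AddHom.coe_mk, Prod.mk.injEq, true_and]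
    ext n
    by_cases h1 : t + 1 ≤ n ∧ n ≤ s
    · rw [if_pos (by omega), if_pos (by omega), if_pos h1]; exact congrArg x.2.2 (by omega)
    · rw [if_neg h1]
      split_ifs <;> first | rfl | omega

variable (s : ℕ) (a c : K)

lemma R1rel (hs : 3 ≤ s) ⦃x y : FreeAlgebra K QT.Gen⦄ (h : QT.Rel K 1 s a c x y) :
    FreeAlgebra.lift K (R1 a c) x = FreeAlgebra.lift K (R1 a c) y := by
  cases h <;> simp only [QT.gen, map_mul, map_add, map_pow, map_smul, map_zero, map_one,
      FreeAlgebra.lift_ι_apply, Nat.sub_self, pow_zero, pow_one, one_mul]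
  case rel_gamma_beta =>
    rw [R1et a c _ (by omega)]
    apply LinearMap.ext; intro x; ext i; fin_cases i <;> simp [R1]
  all_goals
    apply LinearMap.ext; intro x; ext i; fin_cases i <;> simp [R1] <;> ring

lemma R2rel (hs : 3 ≤ s) ⦃x y : FreeAlgebra K QT.Gen⦄ (h : QT.Rel K 1 s a c x y) :
    FreeAlgebra.lift K (R2 (K := K) s) x = FreeAlgebra.lift K (R2 (K := K) s) y := by
  have q1 : ¬ (0 = s - 1) := by omega
  have q2 : ¬ (0 = s) := by omega
  have q3 : ¬ (1 = s - 1) := by omega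
  have q4 : ¬ (1 = s) := by omega
  have q5 : 1 ≤ s := by omega
  cases h <;> simp only [QT.gen, map_mul, map_add, map_pow, map_smul, map_zero, map_one,
      FreeAlgebra.lift_ι_apply, Nat.sub_self, pow_zero, pow_one, one_mul]
  case rel_gamma_beta =>
    apply LinearMap.ext; intro x
    rw [R2et s _ (by omega)]
    simp only [R2, Module.End.mul_apply, LinearMap.coe_mk, AddHom.coe_mk, Prod.mk.injEq, true_and]
    ext n
    by_cases h1 : n = s - 1
    · rw [if_pos h1, if_pos (by omega)]; exact congrArg x.2.2 (by omega)
    by_cases h2 : n = s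
    · rw [if_neg h1, if_pos h2, if_pos (by omega)]; exact congrArg x.2.2 (by omega)
    · rw [if_neg h1, if_neg h2, if_neg (by omega)]
  case rel_eta_gamma =>
    apply LinearMap.ext; intro x
    simp only [R2, Module.End.mul_apply, LinearMap.coe_mk, AddHom.coe_mk, Prod.mk.injEq, true_and]
    ext n
    split_ifs <;> first | rfl | omega
  all_goals
    apply LinearMap.ext; intro x
    simp [R2, q1, q2, q3, q4, q5]
  rfl

lemma R0rel (hs : 3 ≤ s) ⦃x y : FreeAlgebra K QT.Gen⦄ (h : QT.Rel K 1 s a c x y) :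
    FreeAlgebra.lift K (R0 (K := K)) x = FreeAlgebra.lift K (R0 (K := K)) y := by
  have q1 : s - 1 ≠ 0 := by omega
  cases h <;> simp [QT.gen, R0, q1]

end rep

section final
open QT
variable (K : Type) [Field K] (s : ℕ) (a c : K)

lemma qr : QR s a c (E1 K 1 s a c) (E2 K 1 s a c) (Al K 1 s a c) (Be K 1 s a c) (Ga K 1 s a c)
    (Et K 1 s a c) := by
  constructor
  · simpa only [E1, map_mul] using RingQuot.mkAlgHom_rel K (Rel.idem1 (k := 1) (s := s) (a := a) (c := c))
  · simpa only [E2, map_mul] using RingQuot.mkAlgHom_rel K (Rel.idem2 (k := 1) (s := s) (a := a) (c := c))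
  · simpa only [E1, E2, map_mul, map_zero] using
      RingQuot.mkAlgHom_rel K (Rel.orth12 (k := 1) (s := s) (a := a) (c := c))
  · simpa only [E1, E2, map_mul, map_zero] using
      RingQuot.mkAlgHom_rel K (Rel.orth21 (k := 1) (s := s) (a := a) (c := c))
  · simpa only [E1, E2, map_add, map_one] using
      RingQuot.mkAlgHom_rel K (Rel.sum_idem (k := 1) (s := s) (a := a) (c := c))
  · simpa only [E1, Al, map_mul] using
      RingQuot.mkAlgHom_rel K (Rel.al_left (k := 1) (s := s) (a := a) (c := c))
  · simpa only [E1, Al, map_mul] using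
      RingQuot.mkAlgHom_rel K (Rel.al_right (k := 1) (s := s) (a := a) (c := c))
  · simpa only [E1, Be, map_mul] using
      RingQuot.mkAlgHom_rel K (Rel.be_left (k := 1) (s := s) (a := a) (c := c))
  · simpa only [E2, Be, map_mul] using
      RingQuot.mkAlgHom_rel K (Rel.be_right (k := 1) (s := s) (a := a) (c := c))
  · simpa only [E2, Ga, map_mul] using
      RingQuot.mkAlgHom_rel K (Rel.ga_left (k := 1) (s := s) (a := a) (c := c))
  · simpa only [E1, Ga, map_mul] using
      RingQuot.mkAlgHom_rel K (Rel.ga_right (k := 1) (s := s) (a := a) (c := c))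
  · simpa only [E2, Et, map_mul] using
      RingQuot.mkAlgHom_rel K (Rel.et_left (k := 1) (s := s) (a := a) (c := c))
  · simpa only [E2, Et, map_mul] using
      RingQuot.mkAlgHom_rel K (Rel.et_right (k := 1) (s := s) (a := a) (c := c))
  · simpa only [Al, Be, Ga, Et, map_mul, Nat.sub_self, pow_zero, one_mul] using
      RingQuot.mkAlgHom_rel K (Rel.rel_beta_eta (k := 1) (s := s) (a := a) (c := c))
  · simpa only [Al, Be, Ga, Et, map_mul, Nat.sub_self, pow_zero, one_mul] using
      RingQuot.mkAlgHom_rel K (Rel.rel_eta_gamma (k := 1) (s := s) (a := a) (c := c))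
  · simpa only [Al, Be, Ga, Et, map_mul, map_add, map_smul, Nat.sub_self, pow_zero, pow_one,
      one_mul] using
      RingQuot.mkAlgHom_rel K (Rel.rel_alpha_sq (k := 1) (s := s) (a := a) (c := c))
  · simpa only [Be, Ga, Et, map_mul, map_pow] using
      RingQuot.mkAlgHom_rel K (Rel.rel_gamma_beta (k := 1) (s := s) (a := a) (c := c))
  · simpa only [Al, Be, map_mul, map_zero] using
      RingQuot.mkAlgHom_rel K (Rel.rel_alpha_sq_beta (k := 1) (s := s) (a := a) (c := c))
  · simpa only [Al, Ga, map_mul, map_zero] using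
      RingQuot.mkAlgHom_rel K (Rel.rel_gamma_alpha_sq (k := 1) (s := s) (a := a) (c := c))

lemma adj : Algebra.adjoin K {z | Gs (E1 K 1 s a c) (Al K 1 s a c) (Be K 1 s a c) (Ga K 1 s a c)
    (Et K 1 s a c) z} = ⊤ := by
  rw [eq_top_iff]
  rintro x -
  obtain ⟨y, rfl⟩ := RingQuot.mkAlgHom_surjective K (Rel K 1 s a c) x
  induction y using FreeAlgebra.induction with
  | grade0 r => rw [AlgHom.commutes]; exact Subalgebra.algebraMap_mem _ r
  | grade1 g =>
    have sub : ∀ z, Gs (E1 K 1 s a c) (Al K 1 s a c) (Be K 1 s a c) (Ga K 1 s a c)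
        (Et K 1 s a c) z → z ∈ Algebra.adjoin K {z | Gs (E1 K 1 s a c) (Al K 1 s a c)
          (Be K 1 s a c) (Ga K 1 s a c) (Et K 1 s a c) z} := fun z hz => Algebra.subset_adjoin hz
    cases g with
    | e1 => exact sub _ .g1
    | e2 =>
      have : E2 K 1 s a c = 1 - E1 K 1 s a c := by rw [← (qr K s a c).su]; abel
      show E2 K 1 s a c ∈ _
      rw [this]
      exact sub_mem (one_mem _) (sub _ .g1)
    | al => exact sub _ .g2
    | be => exact sub _ .g3
    | ga => exact sub _ .g4
    | et => exact sub _ .g5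
  | mul x y hx hy => rw [map_mul]; exact mul_mem hx hy
  | add x y hx hy => rw [map_add]; exact add_mem hx hy

lemma exP (hs : 3 ≤ s) : ∃ P : Aa K 1 s a c →ₐ[K] K, P (E1 K 1 s a c) = 1 ∧ P (E2 K 1 s a c) = 0 ∧
    P (Al K 1 s a c) = 0 := by
  refine ⟨RingQuot.liftAlgHom K ⟨FreeAlgebra.lift K R0, R0rel s a c hs⟩, ?_, ?_, ?_⟩ <;>
  simp [E1, E2, Al, gen, R0]

/-- a functional from the two representations -/
def FF {A : Type} [Ring A] [Algebra K A] (ρ1 : A →ₐ[K] Module.End K (Fin 6 → K))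
    (ρ2 : A →ₐ[K] Module.End K (K × K × (ℕ → K))) (s j : ℕ) : A →ₗ[K] K where
  toFun x := (ρ2 x (0, 0, Pi.single 0 1)).2.2 j + (if j = s - 1 then ρ1 x (Pi.single 0 1) 2 else 0)
    + (if j = s then ρ1 x (Pi.single 0 1) 3 else 0)
  map_add' x y := by simp; split_ifs <;> ring
  map_smul' r x := by simp; split_ifs <;> ring

lemma exF (hs : 3 ≤ s) (j : ℕ) (hj : j ≤ s) : ∃ f : Aa K 1 s a c →ₗ[K] K,
    FH s (E1 K 1 s a c) (E2 K 1 s a c) (Al K 1 s a c) (Be K 1 s a c) (Ga K 1 s a c)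
      (Et K 1 s a c) j f := by
  obtain ⟨ρ1, h1⟩ : ∃ ρ1 : Aa K 1 s a c →ₐ[K] Module.End K (Fin 6 → K),
      ∀ g, ρ1 (RingQuot.mkAlgHom K (Rel K 1 s a c) (gen K g)) = R1 a c g :=
    ⟨RingQuot.liftAlgHom K ⟨FreeAlgebra.lift K (R1 a c), R1rel s a c hs⟩, by simp [gen]⟩
  obtain ⟨ρ2, h2⟩ : ∃ ρ2 : Aa K 1 s a c →ₐ[K] Module.End K (K × K × (ℕ → K)),
      ∀ g, ρ2 (RingQuot.mkAlgHom K (Rel K 1 s a c) (gen K g)) = R2 s g :=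
    ⟨RingQuot.liftAlgHom K ⟨FreeAlgebra.lift K (R2 s), R2rel s a c hs⟩, by simp [gen]⟩
  refine ⟨FF K ρ1 ρ2 s j, ?_⟩
  have q1 : ¬ (0 = s - 1) := by omega
  have q2 : ¬ (0 = s) := by omega
  constructor
  · simp [FF, E1, h1, h2, R1, R2]
  · simp [FF, Be, h1, h2, R1, R2]
  · simp [FF, Be, Al, h1, h2, R1, R2]
  · simp [FF, Ga, h1, h2, R1, R2]
  · simp [FF, Ga, Al, h1, h2, R1, R2]
  · simp [FF, Ga, Be, h1, h2, R1, R2]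
  · simp [FF, Ga, Be, Al, h1, h2, R1, R2]
  · intro t ht
    have k1 : ∀ i : Fin 6, i = 2 ∨ i = 3 →
        ρ1 (E2 K 1 s a c * Et K 1 s a c ^ t) (Pi.single 0 1) i = 0 := by
      intro i hi
      rcases hi with rfl | rfl <;> simp [E2, h1, R1]
    have k2 : (ρ2 (E2 K 1 s a c * Et K 1 s a c ^ t) (0, 0, Pi.single 0 1)).2.2 j
        = if t = j then 1 else 0 := by
      rcases Nat.eq_zero_or_pos t with rfl | ht0
      · simp [E2, h2, R2, Pi.single_apply, eq_comm]
      · rw [map_mul, map_pow, E2, Et, h2, h2, Module.End.mul_apply, R2et s t ht0]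
        simp only [R2, LinearMap.coe_mk, AddHom.coe_mk, Pi.single_apply]
        split_ifs <;> first | rfl | omega
    simp only [FF, LinearMap.coe_mk, AddHom.coe_mk, k1 2 (Or.inl rfl), k1 3 (Or.inr rfl), k2, ite_self, add_zero]

lemma key' [CharP K 2] (hs : 3 ≤ s) (G : Set (Aa K 1 s a c))
    (hG : ∀ x ∈ G, x ^ 2 ∈ cm K (Aa K 1 s a c))
    (hb : Be K 1 s a c * Ga K 1 s a c * Al K 1 s a c ∈ G)
    (hη : ∀ t, s < 2 * t → t ≤ s - 1 → Et K 1 s a c ^ t ∈ G)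
    (hfin : ∀ (u : K) (v : ℕ → K),
      (∀ j ≤ s, u ^ 2 * ((if j = s - 1 then a else 0) + (if j = s then c else 0)) +
        ∑ t ∈ Finset.range (s / 2 + 1), (if 2 * t = j then v t ^ 2 else 0) = 0) →
      nf s (E1 K 1 s a c) (E2 K 1 s a c) (Al K 1 s a c) (Et K 1 s a c) 0 u v
        ∈ comm K 1 s a c ⊔ Submodule.span K G) :
    T1 K 1 s a c = ↑(comm K 1 s a c ⊔ Submodule.span K G) := by
  obtain ⟨P, P1, P2, P3⟩ := exP K s a c hs
  exact key (qr K s a c) hs (adj K s a c) P P1 P2 P3 (exF K s a c hs) G hG hb hη hfin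

lemma sum_one {s : ℕ} (v : ℕ → K) (i : ℕ) (hi : i ≤ s / 2) :
    ∑ t ∈ Finset.range (s / 2 + 1), (if 2 * t = 2 * i then v t ^ 2 else 0) = v i ^ 2 := by
  rw [Finset.sum_eq_single i]
  · simp
  · intro b _ hb; rw [if_neg (by omega)]
  · intro hh; exact absurd (Finset.mem_range.2 (by omega)) hh

lemma sum_odd {s : ℕ} (v : ℕ → K) (j : ℕ) (hj : Odd j) :
    ∑ t ∈ Finset.range (s / 2 + 1), (if 2 * t = j then v t ^ 2 else 0) = 0 := by
  obtain ⟨m, rfl⟩ := hj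
  apply Finset.sum_eq_zero
  intro t _
  rw [if_neg (by omega)]

/-- basic elements are in T1 -/
lemma sqG (hs : 3 ≤ s) (n : ℕ) (hn : ∀ t, n < 2 * t → s < 2 * t)
    (x : Aa K 1 s a c) (hx : x ∈ etaAbove K 1 s a c n ∪
            {Be K 1 s a c * Ga K 1 s a c * Al K 1 s a c}) : x ^ 2 ∈ cm K (Aa K 1 s a c) := by
  rcases hx with ⟨t, h1, h2, rfl⟩ | rfl
  · rw [← pow_mul, (qr K s a c).eta0 hs (by have := hn t h1; omega)]
    exact zero_mem _
  · rw [(qr K s a c).bega0]; exact zero_mem _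

lemma nf_zero {A : Type} [Ring A] [Algebra K A] (e1 e2 al et : A) (v : ℕ → K)
    (hv : ∀ i ≤ s / 2, v i = 0) : nf s e1 e2 al et (0 : K) 0 v = 0 := by
  unfold nf
  rw [Finset.sum_eq_zero]
  · simp
  · intro i hi; rw [hv i (by have := Finset.mem_range.1 hi; omega), zero_smul]

lemma case_even [CharP K 2] (hs : 3 ≤ s) (ha : a ≠ 0) (he : Even s) :
    (T1 K 1 s a c : Set (Aa K 1 s a c)) =
        ↑(comm K 1 s a c ⊔ Submodule.span K
          (etaAbove K 1 s a c s ∪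
            {Be K 1 s a c * Ga K 1 s a c * Al K 1 s a c})) := by
  apply key' K s a c hs _ (sqG K s a c hs s (fun _ h => h)) (Or.inr rfl)
    (fun t h1 h2 => Or.inl ⟨t, h1, h2, rfl⟩)
  intro u v hj
  obtain ⟨m, hm⟩ := he
  have hu : u = 0 := by
    have := hj (s - 1) (by omega)
    rw [sum_odd K v _ ⟨m - 1, by omega⟩, if_pos rfl, if_neg (by omega)] at this
    simpa [ha] using this
  subst hu
  rw [nf_zero]
  · exact zero_mem _
  · intro i hi
    have := hj (2 * i) (by omega)
    rw [sum_one K v i hi] at this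
    simpa using this

lemma case_odd [CharP K 2] (hs : 3 ≤ s) (ho : Odd s)
    (hu : ∀ u v : K, u ^ 2 * a + v ^ 2 = 0 → u ^ 2 * c = 0 → u = 0) :
    (T1 K 1 s a c : Set (Aa K 1 s a c)) =
        ↑(comm K 1 s a c ⊔ Submodule.span K
          (etaAbove K 1 s a c (s - 1) ∪
            {Be K 1 s a c * Ga K 1 s a c * Al K 1 s a c})) := by
  obtain ⟨m, hm⟩ := ho
  apply key' K s a c hs _ (sqG K s a c hs (s - 1) (fun _ h => by omega)) (Or.inr rfl)
    (fun t h1 h2 => Or.inl ⟨t, by omega, h2, rfl⟩)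
  intro u v hj
  have hu : u = 0 := by
    have h1 := hj s le_rfl
    have h2 := hj (s - 1) (by omega)
    rw [sum_odd K v _ ⟨m, by omega⟩, if_pos rfl, if_neg (by omega)] at h1
    rw [if_pos rfl, if_neg (by omega)] at h2
    have h3 := sum_one K (s := s) v m (by omega)
    rw [show 2 * m = s - 1 by omega] at h3
    rw [h3] at h2
    exact hu u (v m) (by simpa using h2) (by simpa using h1)
  subst hu
  rw [nf_zero]
  · exact zero_mem _
  · intro i hi
    have := hj (2 * i) (by omega)
    rw [sum_one K v i hi] at this
    simpa using this

lemma case_sq [CharP K 2] (hs : 3 ≤ s) (ho : Odd s) (b : K) (hb : a = b ^ 2) :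
    (T1 K 1 s a 0 : Set (Aa K 1 s a 0)) =
        ↑(comm K 1 s a 0 ⊔ Submodule.span K
          ({Al K 1 s a 0 + b • (Et K 1 s a 0) ^ ((s - 1) / 2)} ∪
            etaAbove K 1 s a 0 (s - 1) ∪
            {Be K 1 s a 0 * Ga K 1 s a 0 * Al K 1 s a 0})) := by
  obtain ⟨m, hm⟩ := ho
  have hm2 : (s - 1) / 2 = m := by omega
  have h := qr K s a 0
  rw [hm2]
  apply key' K s a 0 hs
  · rintro x ((rfl | hx) | hx)
    · obtain ⟨n, rfl⟩ : ∃ n, m = n + 1 := ⟨m - 1, by omega⟩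
      have : (Al K 1 s a 0 + b • Et K 1 s a 0 ^ (n + 1)) ^ 2 = a • (Be K 1 s a 0 * Ga K 1 s a 0 -
          Ga K 1 s a 0 * Be K 1 s a 0) := by
        rw [pow_two, add_mul, mul_add, mul_add, mul_smul_comm, smul_mul_assoc, smul_mul_assoc,
          mul_smul_comm, h.alp, h.pal, h.r3, h.r4, ← pow_add, smul_smul, ← pow_two, ← hb,
          show n + 1 + (n + 1) = s - 1 by omega, smul_sub, sub_eq_add_neg,
          neg_self0 (K := K) (a • Et K 1 s a 0 ^ (s - 1))]
        simp
      rw [this]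
      exact Submodule.smul_mem _ _ (cm_comm _ _)
    · exact sqG K s a 0 hs (s - 1) (fun _ h => by omega) x (Or.inl hx)
    · exact sqG K s a 0 hs (s - 1) (fun _ h => by omega) x (Or.inr hx)
  · exact Or.inr rfl
  · exact fun t h1 h2 => Or.inl (Or.inr ⟨t, by omega, h2, rfl⟩)
  intro u v hj
  have hv : v m = u * b := by
    have h2 := hj (s - 1) (by omega)
    rw [if_pos rfl, if_neg (by omega)] at h2
    have h3 := sum_one K (s := s) v m (by omega)
    rw [show 2 * m = s - 1 by omega] at h3
    rw [h3, hb, add_zero, ← mul_pow, ← CharTwo.add_sq] at h2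
    have := pow_eq_zero_iff (two_ne_zero) |>.1 h2
    exact (CharTwo.add_eq_zero.1 this).symm
  have hv0 : ∀ i < m, v i = 0 := by
    intro i hi
    have := hj (2 * i) (by omega)
    rw [sum_one K v i (by omega), if_neg (by omega), if_neg (by omega)] at this
    simpa using this
  have hnf : nf s (E1 K 1 s a 0) (E2 K 1 s a 0) (Al K 1 s a 0) (Et K 1 s a 0) 0 u v =
      u • (Al K 1 s a 0 + b • Et K 1 s a 0 ^ m) := by
    unfold nf
    rw [Finset.sum_eq_single m]
    · rw [hv, h.e2pow' (by omega), smul_add, smul_smul, zero_smul, zero_add]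
    · intro i hi hne
      rw [hv0 i (by have := Finset.mem_range.1 hi; omega), zero_smul]
    · intro hh; exact absurd (Finset.mem_range.2 (by omega)) hh
  rw [hnf]
  exact Submodule.smul_mem _ _ (le_sup_right (a := comm K 1 s a 0)
    (Submodule.subset_span (Or.inl (Or.inl rfl))))

end final
end QTaux

open QT in
/-- char K = 2, k = 1.  In A = A^{1,s}(a,c):
(i) if s is even then for every c, T₁(A) = [A,A] + span({η^t : s/2 < t ≤ s−1} ∪ {βγα});
(ii) if s is odd and c ≠ 0 then T₁(A) = [A,A] + span({η^t : (s−1)/2 < t ≤ s−1} ∪ {βγα});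
(iii) if s is odd, c = 0 and a = b², then
  T₁(A) = [A,A] + span({α + bη^{(s−1)/2}} ∪ {η^t : (s−1)/2 < t ≤ s−1} ∪ {βγα});
(iv) if s is odd, c = 0 and a is not a square, then
  T₁(A) = [A,A] + span({η^t : (s−1)/2 < t ≤ s−1} ∪ {βγα}). -/
theorem statement10 (K : Type) [Field K] [CharP K 2] (s : ℕ) (hs : 3 ≤ s)
    (a : K) (ha : a ≠ 0) :
    (Even s → ∀ c : K,
      (T1 K 1 s a c : Set (Aa K 1 s a c)) =
        ↑(comm K 1 s a c ⊔ Submodule.span K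
          (etaAbove K 1 s a c s ∪
            {Be K 1 s a c * Ga K 1 s a c * Al K 1 s a c}))) ∧
    (Odd s → ∀ c : K, c ≠ 0 →
      (T1 K 1 s a c : Set (Aa K 1 s a c)) =
        ↑(comm K 1 s a c ⊔ Submodule.span K
          (etaAbove K 1 s a c (s - 1) ∪
            {Be K 1 s a c * Ga K 1 s a c * Al K 1 s a c}))) ∧
    (Odd s → ∀ b : K, a = b ^ 2 →
      (T1 K 1 s a 0 : Set (Aa K 1 s a 0)) =
        ↑(comm K 1 s a 0 ⊔ Submodule.span K
          ({Al K 1 s a 0 + b • (Et K 1 s a 0) ^ ((s - 1) / 2)} ∪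
            etaAbove K 1 s a 0 (s - 1) ∪
            {Be K 1 s a 0 * Ga K 1 s a 0 * Al K 1 s a 0}))) ∧
    (Odd s → ¬ IsSquare a →
      (T1 K 1 s a 0 : Set (Aa K 1 s a 0)) =
        ↑(comm K 1 s a 0 ⊔ Submodule.span K
          (etaAbove K 1 s a 0 (s - 1) ∪
            {Be K 1 s a 0 * Ga K 1 s a 0 * Al K 1 s a 0}))) := by
  refine ⟨fun he c => QTaux.case_even K s a c hs ha he, fun ho c hc => ?_,
    fun ho b hb => QTaux.case_sq K s a hs ho b hb, fun ho hsq => ?_⟩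
  · apply QTaux.case_odd K s a c hs ho
    intro u v _ h2
    simpa [hc] using h2
  · apply QTaux.case_odd K s a 0 hs ho
    intro u v h1 _
    by_contra hu
    apply hsq
    refine ⟨v / u, ?_⟩
    rw [CharTwo.add_eq_zero] at h1
    field_simp
    rw [← h1]; ring
end

section
/- Let K have characteristic 2, let k > 1 be odd, s ≥ 3, and let a, c ∈ K be nonzero. If s is even and c is a square in K, then dim_K T₁(A^{k,s}(a,c))^⊥ = dim_K T₁(A^{k,s}(a,0))^⊥. If s is odd, or if c is not a square in K, then dim_K T₁(A^{k,s}(a,c))^⊥ = dim_K T₁(A^{k,s}(a,0))^⊥ + 1. -/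
namespace QP

/-- letters -/
def lt {A : Type} (al be ga : A) (i : ZMod 3) : A :=
  if i = 0 then al else if i = 1 then be else ga

/-- alternating words -/
def w {A : Type} [Ring A] (al be ga : A) : ℕ → ZMod 3 → A
  | 0, _ => 1
  | L + 1, i => lt al be ga i * w al be ga L (i + 1)

/-- abstract data -/
structure QA (K A : Type) [Field K] [Ring A] [Algebra K A] (k s : ℕ) (a c : K) where
  e1 : A
  e2 : A
  al : A
  be : A
  ga : A
  et : A
  ψ : A →ₗ[K] K
  hk : 2 ≤ k
  hs : 3 ≤ s
  ha : a ≠ 0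
  e11 : e1 * e1 = e1
  e22 : e2 * e2 = e2
  e12 : e1 * e2 = 0
  e21 : e2 * e1 = 0
  esum : e1 + e2 = 1
  e1al : e1 * al = al
  ale1 : al * e1 = al
  e1be : e1 * be = be
  bee2 : be * e2 = be
  e2ga : e2 * ga = ga
  gae1 : ga * e1 = ga
  e2et : e2 * et = et
  ete2 : et * e2 = et
  beet : be * et = w al be ga (3 * k - 1) 0
  etga : et * ga = w al be ga (3 * k - 1) 2
  alal : al * al = a • w al be ga (3 * k - 1) 1 + c • w al be ga (3 * k) 1
  gabe : ga * be = et ^ (s - 1)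
  alalbe : al * al * be = 0
  gaalal : ga * (al * al) = 0
  top : ∀ M : Submodule K A, 1 ∈ M → (∀ x ∈ M, e1 * x ∈ M) → (∀ x ∈ M, al * x ∈ M) →
    (∀ x ∈ M, be * x ∈ M) → (∀ x ∈ M, ga * x ∈ M) → (∀ x ∈ M, et * x ∈ M) → M = ⊤
  psi_et : ψ (et ^ s) = 1
  psi_S : ψ (w al be ga (3 * k) 0) = 1
  psi_W0 : ∀ L i, 1 ≤ L → L < 3 * k → w al be ga L i ≠ et ^ s →
    w al be ga L i ≠ w al be ga (3 * k) 0 → ψ (w al be ga L i) = 0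
  psi_et0 : ∀ n, 1 ≤ n → n < s → et ^ n ≠ et ^ s →
    et ^ n ≠ w al be ga (3 * k) 0 → ψ (et ^ n) = 0

namespace QA

variable {K A : Type} [Field K] [Ring A] [Algebra K A] {k s : ℕ} {a c : K}
  (q : QA K A k s a c)

/-- letter -/
def l (i : ZMod 3) : A := lt q.al q.be q.ga i
/-- word -/
def W (L : ℕ) (i : ZMod 3) : A := w q.al q.be q.ga L i

theorem zc (i : ZMod 3) : i = 0 ∨ i = 1 ∨ i = 2 := by revert i; decide

theorem l0 : q.l 0 = q.al := by simp [l, lt]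
theorem l1 : q.l 1 = q.be := by simp [l, lt]
theorem l2 : q.l 2 = q.ga := by
  have h1 : (2 : ZMod 3) ≠ 0 := by decide
  have h2 : (2 : ZMod 3) ≠ 1 := by decide
  simp [l, lt, h1, h2]

theorem W_zero (i) : q.W 0 i = 1 := rfl
theorem W_succ (L i) : q.W (L + 1) i = q.l i * q.W L (i + 1) := rfl
theorem W_one (i) : q.W 1 i = q.l i := by rw [W_succ, W_zero, mul_one]
theorem W_add (L M i) : q.W (L + M) i = q.W L i * q.W M (i + L) := by
  induction L generalizing i with
  | zero => simp [W_zero]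
  | succ n ih =>
    rw [show n + 1 + M = (n + M) + 1 by ring, W_succ, ih, W_succ, mul_assoc]
    push_cast
    rw [show i + 1 + (n : ZMod 3) = i + (n + 1) by ring]
theorem W_succ' (L i) : q.W (L + 1) i = q.W L i * q.l (i + L) := by
  rw [W_add, W_one]

theorem three : (3 : ZMod 3) = 0 := by decide
theorem c3 (n : ℕ) : ((3 * n : ℕ) : ZMod 3) = 0 := by push_cast; rw [three, zero_mul]
theorem c31 (n : ℕ) (h : 1 ≤ n) : ((3 * n - 1 : ℕ) : ZMod 3) = 2 := by
  rw [show 3 * n - 1 = 3 * (n - 1) + 2 by omega, Nat.cast_add, c3]; decide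
theorem c32 (n : ℕ) (h : 1 ≤ n) : ((3 * n - 2 : ℕ) : ZMod 3) = 1 := by
  rw [show 3 * n - 2 = 3 * (n - 1) + 1 by omega, Nat.cast_add, c3]; decide

theorem beet' : q.be * q.et = q.W (3 * k - 1) 0 := q.beet
theorem etga' : q.et * q.ga = q.W (3 * k - 1) 2 := q.etga
theorem alal' : q.al * q.al = a • q.W (3 * k - 1) 1 + c • q.W (3 * k) 1 := q.alal

-- idempotent facts
theorem e1et : q.e1 * q.et = 0 := by rw [← q.e2et, ← mul_assoc, q.e12, zero_mul]
theorem ete1 : q.et * q.e1 = 0 := by rw [← q.ete2, mul_assoc, q.e21, mul_zero]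
theorem e2al : q.e2 * q.al = 0 := by rw [← q.e1al, ← mul_assoc, q.e21, zero_mul]
theorem e2be : q.e2 * q.be = 0 := by rw [← q.e1be, ← mul_assoc, q.e21, zero_mul]
theorem e1ga : q.e1 * q.ga = 0 := by rw [← q.e2ga, ← mul_assoc, q.e12, zero_mul]
theorem ale2 : q.al * q.e2 = 0 := by rw [← q.ale1, mul_assoc, q.e12, mul_zero]
theorem gae2 : q.ga * q.e2 = 0 := by rw [← q.gae1, mul_assoc, q.e12, mul_zero]
theorem bee1 : q.be * q.e1 = 0 := by rw [← q.bee2, mul_assoc, q.e21, mul_zero]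
theorem alga : q.al * q.ga = 0 := by rw [← q.ale1, mul_assoc, q.e1ga, mul_zero]
theorem alet : q.al * q.et = 0 := by rw [← q.ale1, mul_assoc, q.e1et, mul_zero]
theorem gaet : q.ga * q.et = 0 := by rw [← q.gae1, mul_assoc, q.e1et, mul_zero]
theorem gaga : q.ga * q.ga = 0 := by
  nth_rw 1 [← q.gae1]; rw [mul_assoc, q.e1ga, mul_zero]
theorem beal : q.be * q.al = 0 := by rw [← q.bee2, mul_assoc, q.e2al, mul_zero]
theorem bebe : q.be * q.be = 0 := by
  nth_rw 1 [← q.bee2]; rw [mul_assoc, q.e2be, mul_zero]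
theorem etal : q.et * q.al = 0 := by rw [← q.ete2, mul_assoc, q.e2al, mul_zero]
theorem etbe : q.et * q.be = 0 := by rw [← q.ete2, mul_assoc, q.e2be, mul_zero]

theorem albeet : q.al * q.be * q.et = 0 := by
  have hk := q.hk
  rw [mul_assoc, beet', show 3 * k - 1 = (3 * k - 3 + 1) + 1 by omega, W_succ, W_succ, ← mul_assoc,
    ← mul_assoc, l0, zero_add, l1, q.alalbe, zero_mul]
theorem beetet : q.be * q.et * q.et = 0 := by
  have hk := q.hk
  rw [beet', show 3 * k - 1 = 3 * (k - 1) + 1 + 1 by omega, W_succ', W_succ', mul_assoc, mul_assoc]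
  push_cast
  rw [three]; simp only [zero_mul, zero_add, l0, l1]
  rw [← mul_assoc q.al, albeet, mul_zero]
theorem etgaal : q.et * q.ga * q.al = 0 := by
  have hk := q.hk
  rw [etga', show 3 * k - 1 = 3 * (k - 1) + 1 + 1 by omega, W_succ', W_succ', mul_assoc, mul_assoc]
  push_cast
  rw [three]; simp only [zero_mul, zero_add, add_zero, l2]
  rw [show (2 : ZMod 3) + 1 = 0 by decide, l0, q.gaalal, mul_zero]
theorem etetga : q.et * (q.et * q.ga) = 0 := by
  have hk := q.hk
  rw [etga', show 3 * k - 1 = (3 * k - 3 + 1) + 1 by omega, W_succ, W_succ, ← mul_assoc,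
    ← mul_assoc, l2, show (2 : ZMod 3) + 1 = 0 by decide, l0, etgaal, zero_mul]
theorem be_et_pow (n) (h : 2 ≤ n) : q.be * q.et ^ n = 0 := by
  obtain ⟨m, rfl⟩ := Nat.exists_eq_add_of_le h
  rw [pow_add, pow_two, ← mul_assoc, ← mul_assoc, beetet, zero_mul]
theorem et_pow_ga (n) (h : 2 ≤ n) : q.et ^ n * q.ga = 0 := by
  obtain ⟨m, rfl⟩ := Nat.exists_eq_add_of_le h
  rw [add_comm, pow_add, pow_two, mul_assoc, mul_assoc, etetga, mul_zero]
theorem et_s : q.et ^ s = q.W (3 * k) 2 := by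
  have hk := q.hk
  have hs := q.hs
  rw [show 3 * k = (3 * k - 1) + 1 by omega, W_succ, show (2 : ZMod 3) + 1 = 0 by decide, l2,
    ← beet', ← mul_assoc, q.gabe, ← pow_succ]
  congr 1; omega
theorem et_big (n) (h : s < n) : q.et ^ n = 0 := by
  have hs := q.hs
  obtain ⟨m, rfl⟩ := Nat.exists_eq_add_of_le h
  rw [pow_add, show s.succ = (s - 1) + 2 by omega, pow_add, ← q.gabe, mul_assoc q.ga,
    q.be_et_pow 2 le_rfl, mul_zero, zero_mul]

theorem T_a (p j : ZMod 3) (h : j ≠ p + 1) : q.l p * q.l j * q.l (j + 1) = 0 := by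
  have hs := q.hs
  have h2 : (2 : ZMod 3) + 1 = 0 := by decide
  have h3 : (1 : ZMod 3) + 1 = 2 := by decide
  rcases zc p with rfl | rfl | rfl <;> rcases zc j with rfl | rfl | rfl <;>
    simp only [h2, h3, zero_add, ne_eq, not_true, l0, l1, l2] at * <;>
    simp only [q.alalbe, q.alga, q.bebe, q.beal, q.gaga, zero_mul, q.gabe]
  exact q.et_pow_ga _ (by omega)
theorem T_b (p j : ZMod 3) (h : j ≠ p + 1 + 1) : q.l p * (q.l (p + 1) * q.l j) = 0 := by
  have hs := q.hs
  have h2 : (2 : ZMod 3) + 1 = 0 := by decide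
  have h3 : (1 : ZMod 3) + 1 = 2 := by decide
  rcases zc p with rfl | rfl | rfl <;> rcases zc j with rfl | rfl | rfl <;>
    simp only [h2, h3, zero_add, ne_eq, not_true, l0, l1, l2] at * <;>
    simp only [q.gaalal, q.alga, q.bebe, q.beal, q.gaga, mul_zero, q.gabe]
  exact q.be_et_pow _ (by omega)

theorem W_mis (L M : ℕ) (i j : ZMod 3) (hL : 1 ≤ L) (hM : 1 ≤ M) (h : j ≠ i + L)
    (h' : 3 ≤ L + M) : q.W L i * q.W M j = 0 := by
  obtain ⟨L, rfl⟩ := Nat.exists_eq_add_of_le' hL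
  obtain ⟨M, rfl⟩ := Nat.exists_eq_add_of_le' hM
  push_cast at h
  rcases M with _ | M
  · obtain ⟨L, rfl⟩ := Nat.exists_eq_add_of_le' (show 1 ≤ L by omega)
    rw [W_one, W_succ', W_succ', mul_assoc, mul_assoc]
    push_cast at *
    rw [← add_assoc, q.T_b _ _ (by simpa [add_assoc] using h), mul_zero]
  · rw [W_succ', W_succ, W_succ, mul_assoc]
    rw [show q.l (i + L) * (q.l j * (q.l (j + 1) * q.W M (j + 1 + 1))) =
      (q.l (i + L) * q.l j * q.l (j + 1)) * q.W M (j + 1 + 1) by simp only [mul_assoc]]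
    rw [q.T_a _ _ (by simpa [add_assoc] using h), zero_mul, mul_zero]

theorem W_mul (L M : ℕ) (i j : ZMod 3) (h : j = i + L) : q.W L i * q.W M j = q.W (L + M) i := by
  rw [W_add, h]

theorem W_3k_al : q.al * q.W (3 * k) 1 = 0 ∧ q.W (3 * k) 1 = q.W (3 * k) 0 := by
  have hk := q.hk
  have h1 : q.al * (q.al * q.al) = q.al * q.al * q.al := (mul_assoc _ _ _).symm
  have ha2 : q.al * q.W (3 * k - 1) 1 = q.W (3 * k) 0 := by
    rw [← l0, ← W_one, W_mul _ _ _ _ _ (by simp)]; congr 1; omega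
  have ha3 : q.W (3 * k - 1) 1 * q.al = q.W (3 * k) 1 := by
    rw [← l0, ← W_one, W_mul _ _ _ _ _ (by rw [c31 _ (by omega)]; decide)]; congr 1; omega
  have ha4 : q.W (3 * k) 1 * q.al = 0 := by
    rw [← l0, ← W_one, W_mis _ _ _ _ _ (by omega) (by omega) (by rw [c3]; decide) (by omega)]
  have ha5 : q.al * (q.al * q.W (3 * k) 1) = 0 := by
    rw [show 3 * k = (3 * k - 1) + 1 by omega, W_succ, ← mul_assoc, l1, ← mul_assoc, q.alalbe, zero_mul]
  have ha6 : q.al * q.W (3 * k) 0 = 0 := by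
    rw [← l0, ← W_one, W_mis _ _ _ _ _ (by omega) (by omega) (by decide) (by omega)]
  rw [alal', mul_add, add_mul] at h1
  simp only [mul_smul_comm, smul_mul_assoc, ha2, ha3, ha4, smul_zero, add_zero] at h1
  have h2 : q.al * (a • q.W (3 * k) 0 + c • (q.al * q.W (3 * k) 1)) = q.al * (a • q.W (3 * k) 1) := by
    rw [h1]
  rw [mul_add] at h2
  simp only [mul_smul_comm, ha5, ha6, smul_zero, add_zero] at h2
  have h3 : q.al * q.W (3 * k) 1 = 0 := by
    have := congrArg (a⁻¹ • ·) h2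
    simpa [smul_smul, q.ha] using this.symm
  refine ⟨h3, ?_⟩
  rw [h3, smul_zero, add_zero] at h1
  have := congrArg (a⁻¹ • ·) h1
  simpa [smul_smul, q.ha] using this.symm

theorem W_big (L i) (h : 3 * k < L) : q.W L i = 0 := by
  have hk := q.hk
  have hs := q.hs
  obtain ⟨m, rfl⟩ := Nat.exists_eq_add_of_le h
  rw [W_add]
  suffices q.W (3 * k + 1) i = 0 by rw [show (3 * k).succ = 3 * k + 1 from rfl, this, zero_mul]
  rcases zc i with rfl | rfl | rfl
  · rw [W_succ, l0, zero_add, q.W_3k_al.1]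
  · rw [W_succ, l1, show (1 : ZMod 3) + 1 = 2 by decide, ← et_s, be_et_pow _ _ (by omega)]
  · rw [W_succ', c3, add_zero, l2, ← et_s, et_pow_ga _ _ (by omega)]

-- idempotents and words
theorem e1W (L i) (hL : 1 ≤ L) : q.e1 * q.W L i = if i = 2 then 0 else q.W L i := by
  obtain ⟨L, rfl⟩ := Nat.exists_eq_add_of_le' hL
  rw [W_succ, ← mul_assoc]
  rcases zc i with rfl | rfl | rfl
  · rw [l0, q.e1al, if_neg (by decide)]
  · rw [l1, q.e1be, if_neg (by decide)]
  · rw [l2, q.e1ga, zero_mul, if_pos rfl]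
theorem We1 (L i) (hL : 1 ≤ L) : q.W L i * q.e1 = if i + L = 2 then 0 else q.W L i := by
  obtain ⟨L, rfl⟩ := Nat.exists_eq_add_of_le' hL
  rw [W_succ', mul_assoc]
  push_cast
  rw [← add_assoc]
  rcases zc (i + L) with h | h | h <;> rw [h]
  · rw [l0, q.ale1, if_neg (by decide)]
  · rw [l1, q.bee1, mul_zero, if_pos (by decide)]
  · rw [l2, q.gae1, if_neg (by decide)]
theorem e2eq : q.e2 = 1 - q.e1 := by rw [← q.esum]; abel
theorem e2W (L i) (hL : 1 ≤ L) : q.e2 * q.W L i = if i = 2 then q.W L i else 0 := by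
  rw [e2eq, sub_mul, e1W _ _ _ hL, one_mul]; split_ifs <;> simp
theorem We2 (L i) (hL : 1 ≤ L) : q.W L i * q.e2 = if i + L = 2 then q.W L i else 0 := by
  rw [e2eq, mul_sub, We1 _ _ _ hL, mul_one]; split_ifs <;> simp
theorem e1etp (n) (h : 1 ≤ n) : q.e1 * q.et ^ n = 0 := by
  obtain ⟨n, rfl⟩ := Nat.exists_eq_add_of_le' h
  rw [pow_succ', ← mul_assoc, e1et, zero_mul]
theorem etpe1 (n) (h : 1 ≤ n) : q.et ^ n * q.e1 = 0 := by
  obtain ⟨n, rfl⟩ := Nat.exists_eq_add_of_le' h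
  rw [pow_succ, mul_assoc, ete1, mul_zero]
theorem e2etp (n) (h : 1 ≤ n) : q.e2 * q.et ^ n = q.et ^ n := by
  rw [e2eq, sub_mul, e1etp _ _ h, one_mul, sub_zero]
theorem etpe2 (n) (h : 1 ≤ n) : q.et ^ n * q.e2 = q.et ^ n := by
  rw [e2eq, mul_sub, etpe1 _ _ h, mul_one, sub_zero]

-- eta and words
theorem etl (i) (h : i ≠ 2) : q.et * q.l i = 0 := by
  rcases zc i with rfl | rfl | rfl
  · rw [l0, etal]
  · rw [l1, etbe]
  · exact absurd rfl h
theorem let' (i) (h : i ≠ 1) : q.l i * q.et = 0 := by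
  rcases zc i with rfl | rfl | rfl
  · rw [l0, alet]
  · exact absurd rfl h
  · rw [l2, gaet]
theorem etW (L i) (h : 2 ≤ L) : q.et * q.W L i = 0 := by
  obtain ⟨L, rfl⟩ := Nat.exists_eq_add_of_le' h
  rw [show L + 2 = L + 1 + 1 from rfl, W_succ, W_succ]
  by_cases hi : i = 2
  · subst hi
    rw [← mul_assoc, ← mul_assoc, l2, show (2 : ZMod 3) + 1 = 0 by decide, l0, etgaal, zero_mul]
  · rw [← mul_assoc, etl _ _ hi, zero_mul]
theorem Wet (L i) (h : 2 ≤ L) : q.W L i * q.et = 0 := by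
  obtain ⟨L, rfl⟩ := Nat.exists_eq_add_of_le' h
  rw [show L + 2 = L + 1 + 1 from rfl, W_succ', W_succ']
  by_cases hi : i + ((L + 1 : ℕ) : ZMod 3) = 1
  · rw [hi]
    have : i + L = 0 := by
      push_cast at hi
      rw [← add_assoc] at hi
      simpa using hi
    rw [this, mul_assoc, mul_assoc, l0, l1, ← mul_assoc q.al, albeet, mul_zero]
  · rw [mul_assoc, let' _ _ hi, mul_zero]
theorem etpl (n i) (h : 2 ≤ n) : q.et ^ n * q.l i = 0 := by
  by_cases hi : i = 2
  · rw [hi, l2, et_pow_ga _ _ h]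
  · obtain ⟨n, rfl⟩ := Nat.exists_eq_add_of_le' h
    rw [show n + 2 = n + 1 + 1 from rfl, pow_succ, mul_assoc, etl _ _ hi, mul_zero]
theorem letp (n i) (h : 2 ≤ n) : q.l i * q.et ^ n = 0 := by
  by_cases hi : i = 1
  · rw [hi, l1, be_et_pow _ _ h]
  · obtain ⟨n, rfl⟩ := Nat.exists_eq_add_of_le' h
    rw [show n + 2 = n + 1 + 1 from rfl, pow_succ', ← mul_assoc, let' _ _ hi, zero_mul]
theorem etpW (n L i) (hn : 1 ≤ n) (hL : 1 ≤ L) (h : 3 ≤ n + L) : q.et ^ n * q.W L i = 0 := by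
  obtain ⟨L, rfl⟩ := Nat.exists_eq_add_of_le' hL
  rcases L with _ | L
  · rw [W_one, etpl _ _ _ (by omega)]
  · obtain ⟨n, rfl⟩ := Nat.exists_eq_add_of_le' hn
    rw [pow_succ, mul_assoc, etW _ _ _ (by omega), mul_zero]
theorem Wetp (n L i) (hn : 1 ≤ n) (hL : 1 ≤ L) (h : 3 ≤ n + L) : q.W L i * q.et ^ n = 0 := by
  obtain ⟨L, rfl⟩ := Nat.exists_eq_add_of_le' hL
  rcases L with _ | L
  · rw [W_one, letp _ _ _ (by omega)]
  · obtain ⟨n, rfl⟩ := Nat.exists_eq_add_of_le' hn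
    rw [pow_succ', ← mul_assoc, Wet _ _ _ (by omega), zero_mul]

-- psi
theorem psi_3k (i) : q.ψ (q.W (3 * k) i) = 1 := by
  rcases zc i with rfl | rfl | rfl
  · exact q.psi_S
  · rw [q.W_3k_al.2]; exact q.psi_S
  · rw [← et_s]; exact q.psi_et
theorem psi_W (L i) (hL : 1 ≤ L) (h : L < 3 * k) : q.ψ (q.W L i) = 0 := by
  have key : ∀ j, q.W L i ≠ q.W (3 * k) j := by
    intro j hj
    have h1 : q.W L i * q.W (3 * k - L) (i + L) = q.W (3 * k) i := by
      rw [W_mul _ _ _ _ _ rfl]; congr 1; omega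
    have h2 : q.W (3 * k) j * q.W (3 * k - L) (i + L) = 0 := by
      by_cases hc : i + L = j + (3 * k : ℕ)
      · rw [W_mul _ _ _ _ _ hc, W_big _ _ _ (by omega)]
      · rw [W_mis _ _ _ _ _ (by omega) (by omega) hc (by omega)]
    have h3 := q.psi_3k i
    rw [← h1, hj, h2, map_zero] at h3
    exact zero_ne_one h3
  refine q.psi_W0 L i hL h ?_ (key 0)
  rw [et_s]; exact key 2
theorem psi_etp (n) (hn : 1 ≤ n) (h : n < s) : q.ψ (q.et ^ n) = 0 := by
  have hk := q.hk
  have hp := q.psi_et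
  refine q.psi_et0 n hn h ?_ ?_
  · intro h1
    have : q.et ^ n * q.et ^ (s - n) = q.et ^ s * q.et ^ (s - n) := by rw [h1]
    rw [← pow_add, ← pow_add, show n + (s - n) = s by omega, et_big _ (s + _) (by omega)] at this
    rw [this, map_zero] at hp
    exact zero_ne_one hp
  · intro h1
    have h2 : q.et ^ n = q.W (3 * k) 0 := h1
    have : q.et ^ n = 0 := by
      rw [← etpe2 _ _ hn, h2, We2 _ _ _ (by omega), c3, if_neg (by decide)]
    have h5 : q.et ^ s = 0 := by
      obtain ⟨m, hm⟩ := Nat.exists_eq_add_of_le h.le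
      rw [show q.et ^ s = q.et ^ (n + m) by congr 1, pow_add, this, zero_mul]
    rw [h5, map_zero] at hp
    exact zero_ne_one hp
theorem psi_etp' (n) (hn : 1 ≤ n) : q.ψ (q.et ^ n) = if n = s then 1 else 0 := by
  split_ifs with h
  · rw [h, q.psi_et]
  · by_cases h' : n < s
    · rw [psi_etp _ _ hn h']
    · rw [et_big _ _ (by omega), map_zero]
theorem psi_W' (L i) (hL : 1 ≤ L) : q.ψ (q.W L i) = if L = 3 * k then 1 else 0 := by
  split_ifs with h
  · rw [h, psi_3k]
  · by_cases h' : L < 3 * k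
    · rw [psi_W _ _ _ hL h']
    · rw [W_big _ _ _ (by omega), map_zero]
theorem psi_WW (L M i j) (hL : 1 ≤ L) (hM : 1 ≤ M) : q.ψ (q.W L i * q.W M j) =
    if j = i + L ∧ L + M = 3 * k then 1 else if L = 1 ∧ M = 1 ∧ i = 0 ∧ j = 0 then c else 0 := by
  have hk := q.hk
  have hs := q.hs
  by_cases h : j = i + L
  · rw [W_mul _ _ _ _ _ h, psi_W' _ _ _ (by omega)]
    simp only [h, true_and]
    by_cases h2 : L + M = 3 * k
    · simp [h2]
    · rw [if_neg h2, if_neg h2, if_neg]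
      rintro ⟨rfl, rfl, rfl, h3⟩
      simp at h3
  · rw [if_neg (by tauto)]
    by_cases h3 : 3 ≤ L + M
    · rw [W_mis _ _ _ _ _ hL hM h h3, map_zero, if_neg (by omega)]
    · obtain rfl : L = 1 := by omega
      obtain rfl : M = 1 := by omega
      rw [W_one, W_one]
      simp only [true_and]
      rcases zc i with rfl | rfl | rfl <;> rcases zc j with rfl | rfl | rfl <;>
        first
        | exact absurd (by decide) h
        | (simp only [l0, l1, l2, q.bebe, q.gaga, q.alga, q.beal, map_zero]; rw [if_neg (by decide)]; done)
        | skip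
      · rw [if_pos ⟨rfl, rfl⟩, l0, alal', map_add, map_smul, map_smul, psi_W' _ _ _ (by omega),
          psi_3k, if_neg (by omega)]; simp
      · rw [l1, l2, q.gabe, psi_etp' _ _ (by omega), if_neg (by omega), if_neg (by decide)]
theorem psi_etW (n L i) (hn : 1 ≤ n) (hL : 1 ≤ L) : q.ψ (q.et ^ n * q.W L i) = 0 := by
  have hk := q.hk
  by_cases h : 3 ≤ n + L
  · rw [etpW _ _ _ _ hn hL h, map_zero]
  · obtain rfl : L = 1 := by omega
    obtain rfl : n = 1 := by omega
    rw [W_one, pow_one]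
    by_cases hi : i = 2
    · rw [hi, l2, etga', psi_W' _ _ _ (by omega), if_neg (by omega)]
    · rw [etl _ _ hi, map_zero]
theorem psi_Wet (n L i) (hn : 1 ≤ n) (hL : 1 ≤ L) : q.ψ (q.W L i * q.et ^ n) = 0 := by
  have hk := q.hk
  by_cases h : 3 ≤ n + L
  · rw [Wetp _ _ _ _ hn hL h, map_zero]
  · obtain rfl : L = 1 := by omega
    obtain rfl : n = 1 := by omega
    rw [W_one, pow_one]
    by_cases hi : i = 1
    · rw [hi, l1, beet', psi_W' _ _ _ (by omega), if_neg (by omega)]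
    · rw [let' _ _ hi, map_zero]

-- spanning
/-- spanning set -/
def SP : Set A := {x | x = q.e1 ∨ x = q.e2 ∨ (∃ L i, 1 ≤ L ∧ x = q.W L i) ∨ ∃ n, 1 ≤ n ∧ x = q.et ^ n}

theorem SPe1 : q.e1 ∈ Submodule.span K q.SP := Submodule.subset_span (Or.inl rfl)
theorem SPe2 : q.e2 ∈ Submodule.span K q.SP := Submodule.subset_span (Or.inr (Or.inl rfl))
theorem SPW (L i) (h : 1 ≤ L) : q.W L i ∈ Submodule.span K q.SP :=
  Submodule.subset_span (Or.inr (Or.inr (Or.inl ⟨L, i, h, rfl⟩)))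
theorem SPet (n) (h : 1 ≤ n) : q.et ^ n ∈ Submodule.span K q.SP :=
  Submodule.subset_span (Or.inr (Or.inr (Or.inr ⟨n, h, rfl⟩)))

theorem SP_mul (g : A) (h : ∀ x ∈ q.SP, g * x ∈ Submodule.span K q.SP) :
    ∀ x ∈ Submodule.span K q.SP, g * x ∈ Submodule.span K q.SP := by
  intro x hx
  induction hx using Submodule.span_induction with
  | mem x hx => exact h x hx
  | zero => simp
  | add x y _ _ hx hy => rw [mul_add]; exact add_mem hx hy
  | smul r x _ hx => rw [mul_smul_comm]; exact Submodule.smul_mem _ _ hx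

theorem SP_W1 (j) : ∀ x ∈ q.SP, q.W 1 j * x ∈ Submodule.span K q.SP := by
  have hk := q.hk
  have hs := q.hs
  rintro x (rfl | rfl | ⟨L, i, hL, rfl⟩ | ⟨n, hn, rfl⟩)
  · rw [We1 _ _ _ le_rfl]; split_ifs
    · exact zero_mem _
    · exact SPW _ _ _ le_rfl
  · rw [We2 _ _ _ le_rfl]; split_ifs
    · exact SPW _ _ _ le_rfl
    · exact zero_mem _
  · by_cases h : i = j + (1 : ℕ)
    · rw [W_mul _ _ _ _ _ h]; exact SPW _ _ _ (by omega)
    · by_cases h3 : 2 ≤ L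
      · rw [W_mis _ _ _ _ _ le_rfl hL h (by omega)]; exact zero_mem _
      · obtain rfl : L = 1 := by omega
        rw [W_one, W_one]
        rcases zc i with rfl | rfl | rfl <;> rcases zc j with rfl | rfl | rfl <;>
          first
          | exact absurd (by decide) h
          | (simp only [l0, l1, l2, q.bebe, q.gaga, q.alga, q.beal]; exact zero_mem _)
          | skip
        · rw [l0, alal']
          exact add_mem (Submodule.smul_mem _ _ (SPW _ _ _ (by omega)))
            (Submodule.smul_mem _ _ (SPW _ _ _ (by omega)))
        · rw [l1, l2, q.gabe]; exact SPet _ _ (by omega)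
  · by_cases h2 : 2 ≤ n
    · rw [W_one, letp _ _ _ h2]; exact zero_mem _
    · obtain rfl : n = 1 := by omega
      rw [W_one, pow_one]
      by_cases hj : j = 1
      · rw [hj, l1, beet']; exact SPW _ _ _ (by omega)
      · rw [let' _ _ hj]; exact zero_mem _

theorem SP_top : Submodule.span K q.SP = ⊤ := by
  have hk := q.hk
  apply q.top
  · rw [← q.esum]; exact add_mem q.SPe1 q.SPe2
  · apply SP_mul
    rintro x (rfl | rfl | ⟨L, i, hL, rfl⟩ | ⟨n, hn, rfl⟩)
    · rw [q.e11]; exact q.SPe1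
    · rw [q.e12]; exact zero_mem _
    · rw [e1W _ _ _ hL]; split_ifs
      · exact zero_mem _
      · exact SPW _ _ _ hL
    · rw [e1etp _ _ hn]; exact zero_mem _
  · rw [← l0, ← W_one]; exact q.SP_mul _ (q.SP_W1 _)
  · rw [← l1, ← W_one]; exact q.SP_mul _ (q.SP_W1 _)
  · rw [← l2, ← W_one]; exact q.SP_mul _ (q.SP_W1 _)
  · apply SP_mul
    rintro x (rfl | rfl | ⟨L, i, hL, rfl⟩ | ⟨n, hn, rfl⟩)
    · rw [q.ete1]; exact zero_mem _
    · rw [q.ete2, ← pow_one q.et]; exact q.SPet _ le_rfl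
    · by_cases h2 : 2 ≤ L
      · rw [etW _ _ _ h2]; exact zero_mem _
      · obtain rfl : L = 1 := by omega
        rw [W_one]
        by_cases hj : i = 2
        · rw [hj, l2, etga']; exact SPW _ _ _ (by omega)
        · rw [etl _ _ hj]; exact zero_mem _
    · rw [← pow_succ']; exact q.SPet _ (by omega)

theorem span_top (M : Submodule K A) (h1 : q.e1 ∈ M) (h2 : q.e2 ∈ M)
    (h3 : ∀ L i, 1 ≤ L → q.W L i ∈ M) (h4 : ∀ n, 1 ≤ n → q.et ^ n ∈ M) : M = ⊤ := by
  rw [eq_top_iff, ← q.SP_top, Submodule.span_le]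
  rintro x (rfl | rfl | ⟨L, i, hL, rfl⟩ | ⟨n, hn, rfl⟩)
  exacts [h1, h2, h3 _ _ hL, h4 _ hn]

-- trace property
theorem tr_gen (g : A) (h1 : q.ψ (g * q.e1) = q.ψ (q.e1 * g)) (h2 : q.ψ (g * q.e2) = q.ψ (q.e2 * g))
    (h3 : ∀ L i, 1 ≤ L → q.ψ (g * q.W L i) = q.ψ (q.W L i * g))
    (h4 : ∀ n, 1 ≤ n → q.ψ (g * q.et ^ n) = q.ψ (q.et ^ n * g)) (x : A) :
    q.ψ (g * x) = q.ψ (x * g) := by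
  have := q.span_top (LinearMap.ker (q.ψ ∘ₗ LinearMap.mulLeft K g - q.ψ ∘ₗ LinearMap.mulRight K g))
    (by simp [h1]) (by simp [h2]) (fun L i h => by simp [h3 L i h]) (fun n h => by simp [h4 n h])
  have hx : x ∈ (⊤ : Submodule K A) := trivial
  rw [← this] at hx
  simpa [sub_eq_zero] using hx

theorem psi_e1W (L i) (hL : 1 ≤ L) : q.ψ (q.e1 * q.W L i) = q.ψ (q.W L i * q.e1) := by
  rw [e1W _ _ _ hL, We1 _ _ _ hL]
  by_cases h : L = 3 * k
  · rw [h, c3, add_zero]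
  · have := q.psi_W' L i hL
    rw [if_neg h] at this
    split_ifs <;> simp [this]

theorem tr_e1 (x : A) : q.ψ (q.e1 * x) = q.ψ (x * q.e1) := by
  apply q.tr_gen
  · rfl
  · rw [q.e12, q.e21]
  · intro L i hL; exact q.psi_e1W L i hL
  · intro n hn; rw [e1etp _ _ hn, etpe1 _ _ hn]

theorem tr_W1 (j) (x : A) : q.ψ (q.W 1 j * x) = q.ψ (x * q.W 1 j) := by
  apply q.tr_gen
  · rw [q.psi_e1W _ _ le_rfl]
  · rw [e2eq, mul_sub, sub_mul, map_sub, map_sub, q.psi_e1W _ _ le_rfl, mul_one, one_mul]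
  · intro L i hL
    rw [psi_WW _ _ _ _ _ le_rfl hL, psi_WW _ _ _ _ _ hL le_rfl]
    have h1 : (i = j + (1 : ℕ) ∧ 1 + L = 3 * k) ↔ (j = i + L ∧ L + 1 = 3 * k) := by
      constructor
      · rintro ⟨h, h'⟩
        refine ⟨?_, by omega⟩
        have : ((1 + L : ℕ) : ZMod 3) = 0 := by rw [h', c3]
        rw [h, add_assoc, ← Nat.cast_add, this, add_zero]
      · rintro ⟨h, h'⟩
        refine ⟨?_, by omega⟩
        have : ((L + 1 : ℕ) : ZMod 3) = 0 := by rw [h', c3]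
        rw [h, add_assoc, ← Nat.cast_add, this, add_zero]
    have h2 : (1 = 1 ∧ L = 1 ∧ j = 0 ∧ i = 0) ↔ (L = 1 ∧ 1 = 1 ∧ i = 0 ∧ j = 0) := by tauto
    simp only [h1, true_and, and_comm (a := j = 0)]
  · intro n hn
    rw [psi_Wet _ _ _ _ hn le_rfl, psi_etW _ _ _ _ hn le_rfl]

theorem tr_et (x : A) : q.ψ (q.et * x) = q.ψ (x * q.et) := by
  apply q.tr_gen
  · rw [q.e1et, q.ete1]
  · rw [q.e2et, q.ete2]
  · intro L i hL
    have h1 := q.psi_etW 1 L i le_rfl hL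
    have h2 := q.psi_Wet 1 L i le_rfl hL
    rw [pow_one] at h1 h2
    rw [h1, h2]
  · intro n hn
    rw [← pow_succ, ← pow_succ']

theorem tr (x y : A) : q.ψ (x * y) = q.ψ (y * x) := by
  have key : ∀ g : A, (∀ z, q.ψ (g * z) = q.ψ (z * g)) → ∀ x : A, (∀ y, q.ψ (x * y) = q.ψ (y * x)) →
      ∀ y, q.ψ (g * x * y) = q.ψ (y * (g * x)) := by
    intro g hg x hx y
    rw [mul_assoc, hg, mul_assoc, hx, mul_assoc]
  let M : Submodule K A :=
    { carrier := {x | ∀ y, q.ψ (x * y) = q.ψ (y * x)}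
      zero_mem' := by simp
      add_mem' := by intro u v hu hv y; simp only [Set.mem_ofPred_eq] at hu hv; simp [add_mul, mul_add, hu, hv]
      smul_mem' := by intro r u hu y; simp only [Set.mem_ofPred_eq] at hu; simp [hu] }
  have hM : M = ⊤ := by
    apply q.top
    · intro y; simp
    · exact key _ q.tr_e1
    · rw [← l0, ← W_one]; exact key _ (q.tr_W1 _)
    · rw [← l1, ← W_one]; exact key _ (q.tr_W1 _)
    · rw [← l2, ← W_one]; exact key _ (q.tr_W1 _)
    · exact key _ q.tr_et
  have hx : x ∈ (⊤ : Submodule K A) := trivial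
  rw [← hM] at hx
  exact hx y

theorem psi_We1z (L i) (hL : 1 ≤ L) (h : L < 3 * k) : q.ψ (q.W L i * q.e1) = 0 := by
  rw [We1 _ _ _ hL]; split_ifs
  · exact map_zero _
  · exact q.psi_W _ _ hL h
theorem psi_We2z (L i) (hL : 1 ≤ L) (h : L < 3 * k) : q.ψ (q.W L i * q.e2) = 0 := by
  rw [We2 _ _ _ hL]; split_ifs
  · exact q.psi_W _ _ hL h
  · exact map_zero _
theorem Se1 : q.W (3 * k) 0 * q.e1 = q.W (3 * k) 0 := by
  have hk := q.hk
  rw [We1 _ _ _ (by omega), c3, if_neg (by decide)]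
theorem Se2 : q.W (3 * k) 0 * q.e2 = 0 := by
  have hk := q.hk
  rw [We2 _ _ _ (by omega), c3, if_neg (by decide)]
theorem e1S : q.e1 * q.W (3 * k) 0 = q.W (3 * k) 0 := by
  have hk := q.hk
  rw [e1W _ _ _ (by omega), if_neg (by decide)]
theorem e2S : q.e2 * q.W (3 * k) 0 = 0 := by
  have hk := q.hk
  rw [e2W _ _ _ (by omega), if_neg (by decide)]
theorem WWbig (L M i j) (hL : 1 ≤ L) (hM : 1 ≤ M) (h : 3 * k < L + M) : q.W L i * q.W M j = 0 := by
  have hk := q.hk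
  by_cases hc : j = i + L
  · rw [W_mul _ _ _ _ _ hc, W_big _ _ _ h]
  · rw [W_mis _ _ _ _ _ hL hM hc (by omega)]

/-- spanning family -/
def v : Fin 4 ⊕ ((ZMod 3 × Fin (3 * k - 1)) ⊕ Fin (s - 1)) → A :=
  Sum.elim ![q.e1, q.e2, q.W (3 * k) 0, q.et ^ s]
    (Sum.elim (fun p => q.W (p.2 + 1) p.1) (fun t => q.et ^ ((t : ℕ) + 1)))

/-- dual family -/
noncomputable def d : Fin 4 ⊕ ((ZMod 3 × Fin (3 * k - 1)) ⊕ Fin (s - 1)) → A :=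
  Sum.elim ![q.W (3 * k) 0, q.et ^ s, q.e1 - q.ψ q.e1 • q.W (3 * k) 0, q.e2 - q.ψ q.e2 • q.et ^ s]
    (Sum.elim (fun p => q.W (3 * k - 1 - p.2) (p.1 + ((p.2 + 1 : ℕ) : ZMod 3)) -
        if p.1 = 1 ∧ (p.2 : ℕ) = 3 * k - 2 then c • q.W (3 * k - 1) 1 else 0)
      (fun t => q.et ^ (s - 1 - (t : ℕ))))

theorem v_top : Submodule.span K (Set.range q.v) = ⊤ := by
  have hk := q.hk
  have hS : q.W (3 * k) 0 ∈ Submodule.span K (Set.range q.v) := Submodule.subset_span ⟨.inl 2, rfl⟩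
  have hT : q.et ^ s ∈ Submodule.span K (Set.range q.v) := Submodule.subset_span ⟨.inl 3, rfl⟩
  apply q.span_top
  · exact Submodule.subset_span ⟨.inl 0, rfl⟩
  · exact Submodule.subset_span ⟨.inl 1, rfl⟩
  · intro L i hL
    rcases lt_trichotomy L (3 * k) with h | h | h
    · refine Submodule.subset_span ⟨.inr (.inl (i, ⟨L - 1, by omega⟩)), ?_⟩
      simp only [v, Sum.elim_inr, Sum.elim_inl]
      congr 1; omega
    · rw [h]
      rcases zc i with rfl | rfl | rfl
      · exact hS
      · rw [q.W_3k_al.2]; exact hS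
      · rw [← et_s]; exact hT
    · rw [W_big _ _ _ h]; exact zero_mem _
  · intro n hn
    rcases lt_trichotomy n s with h | h | h
    · refine Submodule.subset_span ⟨.inr (.inr ⟨n - 1, by omega⟩), ?_⟩
      simp only [v, Sum.elim_inr]
      congr 1; omega
    · rw [h]; exact hT
    · rw [et_big _ _ h]; exact zero_mem _

theorem dv4 (x : A) (h1 : q.ψ (q.W (3 * k) 0 * x) = 0) (h2 : q.ψ (q.et ^ s * x) = 0)
    (h3 : q.ψ (q.e1 * x) = 0) (h4 : q.ψ (q.e2 * x) = 0) (j : Fin 4) :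
    q.ψ (q.d (.inl j) * x) = 0 := by
  fin_cases j <;> simp [d, sub_mul, h1, h2, h3, h4]

theorem dvW (x : A) (h : ∀ L i, 1 ≤ L → L < 3 * k → q.ψ (q.W L i * x) = 0)
    (p) : q.ψ (q.d (.inr (.inl p)) * x) = 0 := by
  have hk := q.hk
  obtain ⟨i, n, hn⟩ := p
  simp only [d, Sum.elim_inr, Sum.elim_inl, sub_mul, map_sub]
  rw [h _ _ (by omega) (by omega)]
  split_ifs <;> simp [h (3 * k - 1) 1 (by omega) (by omega)]

theorem dv (j j') : q.ψ (q.d j * q.v j') = if j = j' then 1 else 0 := by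
  have hk := q.hk
  have hs := q.hs
  have hSS : q.W (3 * k) 0 * q.W (3 * k) 0 = 0 := q.WWbig _ _ _ _ (by omega) (by omega) (by omega)
  have hTT : q.et ^ s * q.et ^ s = 0 := by rw [← pow_add, et_big _ _ (by omega)]
  have hST : q.W (3 * k) 0 * q.et ^ s = 0 := q.Wetp _ _ _ (by omega) (by omega) (by omega)
  have hTS : q.et ^ s * q.W (3 * k) 0 = 0 := q.etpW _ _ _ (by omega) (by omega) (by omega)
  have hTe1 := q.etpe1 s (by omega)
  have hTe2 := q.etpe2 s (by omega)
  have he1T := q.e1etp s (by omega)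
  have he2T := q.e2etp s (by omega)
  have pS := q.psi_3k 0
  have pT := q.psi_et
  rcases j' with j' | ⟨i', n', hn'⟩ | ⟨t', ht'⟩
  · rcases j with j | p | t
    · fin_cases j <;> fin_cases j' <;>
        simp [d, v, sub_mul, Se1, Se2, e1S, e2S, q.e11, q.e22, q.e12, q.e21, hSS, hTT, hST, hTS, hTe1,
          hTe2, he1T, he2T, pS, pT]
    · rw [if_neg (by simp)]
      apply q.dvW
      intro L i h1 h2
      fin_cases j'
      · exact q.psi_We1z _ _ h1 h2
      · exact q.psi_We2z _ _ h1 h2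
      · exact (congrArg _ (q.WWbig _ _ _ _ h1 (by omega) (by omega))).trans (map_zero _)
      · exact q.psi_Wet _ _ _ (by omega) h1
    · rw [if_neg (by simp)]
      obtain ⟨t, ht⟩ := t
      have h1 := q.psi_etp (s - 1 - t) (by omega) (by omega)
      fin_cases j' <;> simp only [d, v, Sum.elim_inr, Sum.elim_inl]
      · show q.ψ (_ * q.e1) = 0
        rw [etpe1 _ _ (by omega), map_zero]
      · show q.ψ (_ * q.e2) = 0
        rw [etpe2 _ _ (by omega), h1]
      · exact q.psi_etW _ _ _ (by omega) (by omega)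
      · show q.ψ (_ * q.et ^ s) = 0
        rw [← pow_add, et_big _ _ (by omega), map_zero]
  · have hv : q.v (.inr (.inl (i', ⟨n', hn'⟩))) = q.W (n' + 1) i' := rfl
    rw [hv]
    rcases j with j | ⟨i, n, hn⟩ | ⟨t, ht⟩
    · rw [if_neg (by simp)]
      apply q.dv4
      · rw [WWbig _ _ _ _ _ (by omega) (by omega) (by omega), map_zero]
      · rw [psi_etW _ _ _ _ (by omega) (by omega)]
      · rw [tr, psi_We1z _ _ _ (by omega) (by omega)]
      · rw [tr, psi_We2z _ _ _ (by omega) (by omega)]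
    · simp only [d, Sum.elim_inr, Sum.elim_inl, sub_mul, map_sub]
      rw [psi_WW _ _ _ _ _ (by omega) (by omega)]
      have hcast : i + ((n + 1 : ℕ) : ZMod 3) + ((3 * k - 1 - n : ℕ) : ZMod 3) = i := by
        rw [add_assoc, ← Nat.cast_add, show n + 1 + (3 * k - 1 - n) = 3 * k by omega, c3, add_zero]
      rw [hcast]
      have h2 : (if i = 1 ∧ n = 3 * k - 2 then c • q.W (3 * k - 1) 1 else 0) =
        (if i = 1 ∧ n = 3 * k - 2 then c else 0) • q.W (3 * k - 1) 1 := by split_ifs <;> simp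
      have hP : q.ψ (q.W (3 * k - 1) 1 * q.W (n' + 1) i') =
          if i' = 0 ∧ 3 * k - 1 + (n' + 1) = 3 * k then 1 else 0 := by
        rw [psi_WW _ _ _ _ _ (by omega) (by omega), c31 _ (by omega),
          show (1 : ZMod 3) + 2 = 0 by decide, if_neg (t := c) (by omega)]
      rw [h2, smul_mul_assoc, map_smul, hP]
      have h3 : (3 * k - 1 - n = 1 ∧ n' + 1 = 1 ∧ i + ((n + 1 : ℕ) : ZMod 3) = 0 ∧ i' = 0) ↔
          ((i = 1 ∧ n = 3 * k - 2) ∧ (i' = 0 ∧ 3 * k - 1 + (n' + 1) = 3 * k)) := by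
        constructor
        · rintro ⟨h4, h5, h6, h7⟩
          have : n + 1 = 3 * k - 1 := by omega
          rw [this, c31 _ (by omega)] at h6
          refine ⟨⟨?_, by omega⟩, h7, by omega⟩
          rcases zc i with rfl | rfl | rfl
          · exact absurd h6 (by decide)
          · rfl
          · exact absurd h6 (by decide)
        · rintro ⟨⟨h4, h5⟩, h6, h7⟩
          refine ⟨by omega, by omega, ?_, h6⟩
          have : n + 1 = 3 * k - 1 := by omega
          rw [this, c31 _ (by omega), h4]; decide
      have h4 : (i' = i ∧ 3 * k - 1 - n + (n' + 1) = 3 * k) ↔ (i = i' ∧ n = n') := by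
        constructor
        · rintro ⟨h, h'⟩; exact ⟨h.symm, by omega⟩
        · rintro ⟨h, h'⟩; exact ⟨h.symm, by omega⟩
      simp only [h3, h4, Sum.inr.injEq, Sum.inl.injEq, Prod.mk.injEq, Fin.mk.injEq, smul_eq_mul]
      by_cases h5 : i = i' ∧ n = n'
      · have h9 : ¬ ((i = 1 ∧ n = 3 * k - 2) ∧ (i' = 0 ∧ 3 * k - 1 + (n' + 1) = 3 * k)) := by
          rintro ⟨⟨h6, h6'⟩, h7, h8⟩
          omega
        rw [if_pos h5, if_pos h5]
        by_cases h6 : i = 1 ∧ n = 3 * k - 2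
        · have h7 : ¬ (i' = 0 ∧ 3 * k - 1 + (n' + 1) = 3 * k) := fun h => h9 ⟨h6, h⟩
          rw [if_neg h7, mul_zero, sub_zero]
        · rw [if_neg h6, zero_mul, sub_zero]
      · rw [if_neg h5, if_neg h5]
        by_cases h6 : i = 1 ∧ n = 3 * k - 2 <;> by_cases h7 : i' = 0 ∧ 3 * k - 1 + (n' + 1) = 3 * k <;>
          simp [h6, h7, h5]
    · rw [if_neg (by simp)]
      exact q.psi_etW _ _ _ (by omega) (by omega)
  · have hv : q.v (.inr (.inr ⟨t', ht'⟩)) = q.et ^ (t' + 1) := rfl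
    rw [hv]
    rcases j with j | p | ⟨t, ht⟩
    · rw [if_neg (by simp)]
      apply q.dv4
      · rw [psi_Wet _ _ _ _ (by omega) (by omega)]
      · rw [← pow_add, et_big _ _ (by omega), map_zero]
      · rw [e1etp _ _ (by omega), map_zero]
      · rw [e2etp _ _ (by omega), psi_etp _ _ (by omega) (by omega)]
    · rw [if_neg (by simp)]
      apply q.dvW
      intro L i h1 h2
      exact q.psi_Wet _ _ _ (by omega) h1
    · simp only [d, Sum.elim_inr]
      rw [← pow_add, psi_etp' _ _ (by omega)]
      simp only [Sum.inr.injEq, Fin.mk.injEq]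
      congr 1
      simp only [eq_iff_iff]; omega

theorem nondeg (z : A) (h : ∀ x, q.ψ (z * x) = 0) : z = 0 := by
  have hz : z ∈ Submodule.span K (Set.range q.v) := by rw [v_top]; trivial
  rw [Submodule.mem_span_range_iff_exists_fun] at hz
  obtain ⟨f, rfl⟩ := hz
  have hf : ∀ j, f j = 0 := by
    intro j
    have := h (q.d j)
    rw [tr, Finset.mul_sum, map_sum] at this
    simpa [dv] using this
  simp [hf]

end QA
/-- commutator space -/
def cm (K A : Type) [Field K] [Ring A] [Algebra K A] : Submodule K A :=
  Submodule.span K {z : A | ∃ u v : A, z = u * v - v * u}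

section cm
variable {K A : Type} [Field K] [Ring A] [Algebra K A]
theorem cm_mem (u v : A) : u * v - v * u ∈ cm K A := Submodule.subset_span ⟨u, v, rfl⟩

theorem two0 [CharP K 2] (x : A) : x + x = 0 := by
  have : (2 : K) = 0 := CharTwo.two_eq_zero
  rw [← two_smul K, this, zero_smul]

theorem sq_add [CharP K 2] (x y : A) : (x + y) ^ 2 - (x ^ 2 + y ^ 2) ∈ cm K A := by
  have : (x + y) ^ 2 - (x ^ 2 + y ^ 2) = (x * y - y * x) + (y * x + y * x) := by noncomm_ring
  rw [this, two0 (K := K), add_zero]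
  exact cm_mem x y

theorem sq_cm [CharP K 2] (x : A) (hx : x ∈ cm K A) : x ^ 2 ∈ cm K A := by
  induction hx using Submodule.span_induction with
  | mem x hx =>
    obtain ⟨u, v, rfl⟩ := hx
    have : (u * v - v * u) ^ 2 = (u * (v * u * v) - v * u * v * u) + (v * u * v * u + v * u * v * u)
       - ((u * v) * (v * u) - (v * u) * (u * v)) - ((v * u) * (u * v) + (v * u) * (u * v)) := by
      noncomm_ring
    rw [this, two0 (K := K), two0 (K := K), add_zero, sub_zero]
    exact sub_mem (cm_mem _ _) (cm_mem _ _)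
  | zero => simp
  | add x y _ _ hx hy =>
    have := add_mem (sq_add (K := K) x y) (add_mem hx hy)
    simpa using this
  | smul r x _ hx => rw [smul_pow]; exact Submodule.smul_mem _ _ hx

theorem sq_sum [CharP K 2] {ι : Type} (S : Finset ι) (f : ι → A) :
    (∑ i ∈ S, f i) ^ 2 - ∑ i ∈ S, f i ^ 2 ∈ cm K A := by
  classical
  induction S using Finset.induction_on with
  | empty => simp
  | insert i S hi ih =>
    rw [Finset.sum_insert hi, Finset.sum_insert hi]
    have := add_mem (sq_add (K := K) (f i) (∑ i ∈ S, f i)) ih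
    convert this using 1
    abel
end cm

namespace QA
variable {K A : Type} [Field K] [Ring A] [Algebra K A] {k s : ℕ} {a c : K}
  (q : QA K A k s a c)

/-- representatives of the basis modulo commutators -/
def rep : Fin 4 ⊕ (Fin (k - 1) ⊕ Fin (s - 1)) → A :=
  Sum.elim ![q.e1, q.e2, q.W 1 0, q.W (3 * k) 0]
    (Sum.elim (fun m => q.W (3 * (m + 1)) 0) (fun t => q.et ^ ((t : ℕ) + 1)))

/-- dual central elements -/
noncomputable def zd : Fin 4 ⊕ (Fin (k - 1) ⊕ Fin (s - 1)) → A :=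
  Sum.elim ![q.W (3 * k) 0, q.et ^ s, q.W (3 * k - 1) 1,
      1 - q.ψ q.e1 • q.W (3 * k) 0 - q.ψ q.e2 • q.et ^ s]
    (Sum.elim (fun m => q.W (3 * (k - 1 - m)) 0 + q.W (3 * (k - 1 - m)) 1 + q.W (3 * (k - 1 - m)) 2)
      (fun t => q.et ^ (s - 1 - (t : ℕ)) + if (t : ℕ) = s - 2 then q.W (3 * k - 2) 0 else 0))

theorem W_rot (L : ℕ) (i : ZMod 3) (hL : 1 ≤ L) (h3 : (L : ZMod 3) = 0) : q.W L i - q.W L (i + 1) ∈ cm K A := by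
  obtain ⟨L, rfl⟩ := Nat.exists_eq_add_of_le' hL
  have : q.W (L + 1) (i + 1) = q.W L (i + 1) * q.l i := by
    rw [W_succ']
    push_cast at h3
    rw [add_assoc, add_comm 1, h3, add_zero]
  rw [this, W_succ]
  exact cm_mem _ _

theorem W_rot0 (L : ℕ) (i : ZMod 3) (hL : 1 ≤ L) (h3 : (L : ZMod 3) = 0) : q.W L i - q.W L 0 ∈ cm K A := by
  rcases zc i with rfl | rfl | rfl
  · simp
  · have := q.W_rot L 0 hL h3
    rw [zero_add] at this
    rw [← neg_sub]; exact neg_mem this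
  · have := q.W_rot L 2 hL h3
    rwa [show (2 : ZMod 3) + 1 = 0 by decide] at this

theorem W_cm (L : ℕ) (i : ZMod 3) (hL : 3 ≤ L) (h3 : (L : ZMod 3) ≠ 0) : q.W L i ∈ cm K A := by
  obtain ⟨L, rfl⟩ := Nat.exists_eq_add_of_le' (show 1 ≤ L by omega)
  have h := cm_mem (K := K) (q.W 1 i) (q.W L (i + 1))
  rw [W_mis q L 1 (i + 1) i (by omega) le_rfl _ (by omega), sub_zero] at h
  · rwa [W_one, ← W_succ] at h
  · intro h4
    apply h3
    push_cast
    have h5 : i + 0 = i + (L + 1) := by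
      rw [add_zero]; nth_rw 1 [h4]; ring
    exact (add_left_cancel h5).symm

theorem ST_cm : q.et ^ s - q.W (3 * k) 0 ∈ cm K A := by
  have hk := q.hk
  rw [et_s]; exact q.W_rot0 _ _ (by omega) (c3 _)

theorem rep_top : cm K A ⊔ Submodule.span K (Set.range q.rep) = ⊤ := by
  have hk := q.hk
  have hs := q.hs
  have hr : ∀ j, q.rep j ∈ cm K A ⊔ Submodule.span K (Set.range q.rep) := fun j =>
    Submodule.mem_sup_right (Submodule.subset_span ⟨j, rfl⟩)
  have hcm : ∀ x ∈ cm K A, x ∈ cm K A ⊔ Submodule.span K (Set.range q.rep) := fun x hx =>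
    Submodule.mem_sup_left hx
  have het : ∀ n, 1 ≤ n → q.et ^ n ∈ cm K A ⊔ Submodule.span K (Set.range q.rep) := by
    intro n hn
    rcases lt_trichotomy n s with h | h | h
    · have := hr (.inr (.inr ⟨n - 1, by omega⟩))
      simp only [rep, Sum.elim_inr] at this
      rwa [show n - 1 + 1 = n by omega] at this
    · rw [h]
      have := add_mem (hcm _ q.ST_cm) (hr (.inl 3))
      simpa [rep] using this
    · rw [et_big _ _ h]; exact zero_mem _
  apply q.span_top
  · exact hr (.inl 0)
  · exact hr (.inl 1)
  · intro L i hL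
    by_cases h3 : (L : ZMod 3) = 0
    · have h4 : q.W L 0 ∈ cm K A ⊔ Submodule.span K (Set.range q.rep) := by
        obtain ⟨m, rfl⟩ : 3 ∣ L := (ZMod.natCast_eq_zero_iff L 3).1 h3
        rcases lt_trichotomy m k with h | h | h
        · have := hr (.inr (.inl ⟨m - 1, by omega⟩))
          simp only [rep, Sum.elim_inr, Sum.elim_inl] at this
          rwa [show m - 1 + 1 = m by omega] at this
        · rw [h]; exact hr (.inl 3)
        · rw [W_big _ _ _ (by omega)]; exact zero_mem _
      have := add_mem (hcm _ (q.W_rot0 L i hL h3)) h4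
      simpa using this
    · by_cases h4 : 3 ≤ L
      · exact hcm _ (q.W_cm L i h4 h3)
      · obtain rfl | rfl : L = 1 ∨ L = 2 := by omega
        · by_cases hi : i = 0
          · rw [hi]; exact hr (.inl 2)
          · have h1 := cm_mem (K := K) (q.W 1 i) q.e1
            rw [We1 _ _ _ le_rfl, e1W _ _ _ le_rfl] at h1
            rcases zc i with rfl | rfl | rfl
            · exact absurd rfl hi
            · rw [if_pos (by decide), if_neg (by decide), zero_sub] at h1
              exact hcm _ (by simpa using neg_mem h1)
            · rw [if_neg (by decide), if_pos (by decide), sub_zero] at h1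
              exact hcm _ h1
        · rw [show 2 = 1 + 1 from rfl, W_add, W_one, W_one]
          have h1 := cm_mem (K := K) (q.l i) (q.l (i + 1))
          have h2 : q.l (i + 1) * q.l i ∈ cm K A ⊔ Submodule.span K (Set.range q.rep) := by
            rcases zc i with rfl | rfl | rfl
            · rw [zero_add, l1, l0, beal]; exact zero_mem _
            · rw [show (1 : ZMod 3) + 1 = 2 by decide, l1, l2, q.gabe]; exact het _ (by omega)
            · rw [show (2 : ZMod 3) + 1 = 0 by decide, l0, l2, alga]; exact zero_mem _
          have := add_mem (hcm _ h1) h2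
          simpa using this
  · exact het

-- centrality
theorem cent (z : A) (h1 : z * q.e1 = q.e1 * z) (h2 : ∀ j, z * q.l j = q.l j * z)
    (h3 : z * q.et = q.et * z) (x : A) : z * x = x * z := by
  let M : Submodule K A := LinearMap.ker (LinearMap.mulLeft K z - LinearMap.mulRight K z)
  have hm : ∀ x, x ∈ M ↔ z * x = x * z := by intro x; simp [M, sub_eq_zero]
  have key : ∀ g : A, z * g = g * z → ∀ x ∈ M, g * x ∈ M := by
    intro g hg x hx
    rw [hm] at *
    rw [← mul_assoc, hg, mul_assoc, hx, mul_assoc]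
  have hM : M = ⊤ := by
    apply q.top
    · rw [hm]; simp
    · exact key _ h1
    · rw [← l0]; exact key _ (h2 _)
    · rw [← l1]; exact key _ (h2 _)
    · rw [← l2]; exact key _ (h2 _)
    · exact key _ h3
  rw [← hm, hM]; trivial

theorem cent_S (x : A) : q.W (3 * k) 0 * x = x * q.W (3 * k) 0 := by
  have hk := q.hk
  apply q.cent
  · rw [Se1, e1S]
  · intro j
    rw [← W_one, WWbig _ _ _ _ _ (by omega) le_rfl (by omega),
      WWbig _ _ _ _ _ le_rfl (by omega) (by omega)]
  · rw [Wet _ _ _ (by omega), etW _ _ _ (by omega)]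

theorem cent_et (n) (hn : 2 ≤ n) (x : A) : q.et ^ n * x = x * q.et ^ n := by
  apply q.cent
  · rw [etpe1 _ _ (by omega), e1etp _ _ (by omega)]
  · intro j; rw [etpl _ _ _ hn, letp _ _ _ hn]
  · rw [← pow_succ, ← pow_succ']

theorem cent_P (x : A) : q.W (3 * k - 1) 1 * x = x * q.W (3 * k - 1) 1 := by
  have hk := q.hk
  apply q.cent
  · rw [We1 _ _ _ (by omega), e1W _ _ _ (by omega), c31 _ (by omega), if_neg (by decide), if_neg (by decide)]
  · intro j
    rw [← W_one]
    by_cases hj : j = 0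
    · subst hj
      rw [W_mul _ _ _ _ _ (by rw [c31 _ (by omega)]; decide), W_mul _ _ _ _ _ (by decide),
        show 3 * k - 1 + 1 = 3 * k by omega, show 1 + (3 * k - 1) = 3 * k by omega, q.W_3k_al.2]
    · rw [W_mis _ _ _ _ _ (by omega) (by omega) _ (by omega), W_mis _ _ _ _ _ (by omega) (by omega) _ (by omega)]
      · intro h; apply hj
        rcases zc j with rfl | rfl | rfl
        · rfl
        · exact absurd h (by decide)
        · exact absurd h (by decide)
      · rw [c31 _ (by omega)]; rwa [show (1 : ZMod 3) + 2 = 0 by decide]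
  · rw [Wet _ _ _ (by omega), etW _ _ _ (by omega)]

theorem cent_Z (L : ℕ) (hL : 2 ≤ L) (h3 : (L : ZMod 3) = 0) (x : A) :
    (q.W L 0 + q.W L 1 + q.W L 2) * x = x * (q.W L 0 + q.W L 1 + q.W L 2) := by
  apply q.cent
  · simp only [add_mul, mul_add, We1 q L _ (by omega : 1 ≤ L), e1W q L _ (by omega : 1 ≤ L), h3, add_zero]
  · have h1 : ∀ i j, q.W L i * q.l j = if i = j then q.W (L + 1) j else 0 := by
      intro i j
      rw [← W_one]
      split_ifs with h
      · rw [h, W_mul _ _ _ _ _ (by rw [h3, add_zero])]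
      · rw [W_mis _ _ _ _ _ (by omega) (by omega) (by rw [h3, add_zero]; exact fun h' => h h'.symm) (by omega)]
    have h2 : ∀ i j, q.l j * q.W L i = if i = j + 1 then q.W (L + 1) j else 0 := by
      intro i j
      rw [← W_one]
      split_ifs with h
      · rw [W_mul _ _ _ _ _ (by rw [h, Nat.cast_one]), add_comm]
      · rw [W_mis _ _ _ _ _ (by omega) (by omega) (by rwa [Nat.cast_one]) (by omega)]
    intro j
    simp only [add_mul, mul_add, h1, h2]
    rcases zc j with rfl | rfl | rfl
    · rw [if_pos rfl, if_neg (by decide), if_neg (by decide), if_neg (by decide), if_pos (by decide), if_neg (by decide)]; abel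
    · rw [if_neg (by decide), if_pos rfl, if_neg (by decide), if_neg (by decide), if_neg (by decide), if_pos (by decide)]
      abel
    · rw [if_neg (by decide), if_neg (by decide), if_pos rfl, if_pos (by decide), if_neg (by decide), if_neg (by decide)]; abel
  · simp only [add_mul, mul_add, Wet q L _ hL, etW q L _ hL]

theorem cent_C (x : A) : (q.et + q.W (3 * k - 2) 0) * x = x * (q.et + q.W (3 * k - 2) 0) := by
  have hk := q.hk
  apply q.cent
  · rw [add_mul, mul_add, ete1, e1et, We1 _ _ _ (by omega), e1W _ _ _ (by omega), c32 _ (by omega),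
      if_neg (by decide), if_neg (by decide)]
  · intro j
    rw [add_mul, mul_add]
    rcases zc j with rfl | rfl | rfl
    · rw [etl _ _ (by decide), let' _ _ (by decide), ← W_one,
        W_mis _ _ _ _ _ (by omega) (by omega) (by rw [c32 _ (by omega)]; decide) (by omega),
        W_mis _ _ _ _ _ (by omega) (by omega) (by decide) (by omega)]
    · rw [etl _ _ (by decide), ← W_one, W_mul _ _ _ _ _ (by rw [c32 _ (by omega)]; decide),
        W_mis _ _ _ _ _ (by omega) (by omega) (by decide) (by omega), W_one, l1, beet', zero_add, add_zero]
      congr 1; omega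
    · rw [let' _ _ (by decide), ← W_one, W_mis _ _ _ _ _ (by omega) (by omega) (by rw [c32 _ (by omega)]; decide) (by omega),
        W_mul _ _ _ _ _ (by decide), W_one, l2, etga', zero_add, add_zero]
      congr 1; omega
  · rw [add_mul, mul_add, Wet _ _ _ (by omega), etW _ _ _ (by omega)]

theorem cent_zd (j) (x : A) : q.zd j * x = x * q.zd j := by
  have hk := q.hk
  have hs := q.hs
  rcases j with j | ⟨m, hm⟩ | ⟨t, ht⟩
  · fin_cases j
    · exact q.cent_S x
    · exact q.cent_et s (by omega) x
    · exact q.cent_P x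
    · show (1 - q.ψ q.e1 • q.W (3 * k) 0 - q.ψ q.e2 • q.et ^ s) * x =
        x * (1 - q.ψ q.e1 • q.W (3 * k) 0 - q.ψ q.e2 • q.et ^ s)
      simp only [sub_mul, mul_sub, smul_mul_assoc, mul_smul_comm, q.cent_S x, q.cent_et s (by omega) x,
        one_mul, mul_one]
  · exact q.cent_Z _ (by omega) (c3 _) x
  · simp only [zd, Sum.elim_inr]
    split_ifs with h
    · rw [show s - 1 - t = 1 by omega, pow_one]; exact q.cent_C x
    · rw [add_zero]; exact q.cent_et _ (by omega) x

theorem psi_cm (j) (x : A) (hx : x ∈ cm K A) : q.ψ (q.zd j * x) = 0 := by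
  induction hx using Submodule.span_induction with
  | mem x hx =>
    obtain ⟨u, v, rfl⟩ := hx
    rw [mul_sub, map_sub, ← mul_assoc, tr, ← mul_assoc v, ← cent_zd, mul_assoc, sub_self]
  | zero => simp
  | add x y _ _ hx hy => rw [mul_add, map_add, hx, hy, add_zero]
  | smul r x _ hx => rw [mul_smul_comm, map_smul, hx, smul_zero]

end QA

namespace QA
variable {K A : Type} [Field K] [Ring A] [Algebra K A] {k s : ℕ} {a c : K}
  (q : QA K A k s a c)

theorem zr (j j') : q.ψ (q.zd j * q.rep j') = if j = j' then 1 else 0 := by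
  have hk := q.hk
  have hs := q.hs
  have hSS : q.W (3 * k) 0 * q.W (3 * k) 0 = 0 := q.WWbig _ _ _ _ (by omega) (by omega) (by omega)
  have hTS : q.et ^ s * q.W (3 * k) 0 = 0 := q.etpW _ _ _ (by omega) (by omega) (by omega)
  have hTe1 := q.etpe1 s (by omega)
  have hTe2 := q.etpe2 s (by omega)
  have pS := q.psi_3k 0
  have pT := q.psi_et
  have pP1 := q.psi_We1z (3 * k - 1) 1 (by omega) (by omega)
  have pP2 := q.psi_We2z (3 * k - 1) 1 (by omega) (by omega)
  have hSa : q.W (3 * k) 0 * q.W 1 0 = 0 := q.WWbig _ _ _ _ (by omega) (by omega) (by omega)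
  have hTa : q.et ^ s * q.W 1 0 = 0 := q.etpW _ _ _ (by omega) (by omega) (by omega)
  have hPS : q.W (3 * k - 1) 1 * q.W (3 * k) 0 = 0 := q.WWbig _ _ _ _ (by omega) (by omega) (by omega)
  have pa := q.psi_W 1 0 le_rfl (by omega)
  have pPa : q.ψ (q.W (3 * k - 1) 1 * q.W 1 0) = 1 := by
    rw [psi_WW _ _ _ _ _ (by omega) (by omega), c31 _ (by omega), if_pos]
    exact ⟨by decide, by omega⟩
  rcases j' with j' | ⟨m', hm'⟩ | ⟨t', ht'⟩
  · rcases j with j | ⟨m, hm⟩ | ⟨t, ht⟩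
    · fin_cases j <;> fin_cases j' <;>
        simp [zd, rep, sub_mul, Se1, Se2, hSS, hTS, hTe1, hTe2, pS, pT, pP1, pP2, hSa, hTa, hPS, pa, pPa]
    · rw [if_neg (by simp)]
      simp only [zd, Sum.elim_inr, Sum.elim_inl]
      have h1 : ∀ i, q.ψ (q.W (3 * (k - 1 - m)) i * q.rep (.inl j')) = 0 := by
        intro i
        fin_cases j'
        · exact q.psi_We1z _ _ (by omega) (by omega)
        · exact q.psi_We2z _ _ (by omega) (by omega)
        · show q.ψ (_ * q.W 1 0) = 0
          rw [psi_WW _ _ _ _ _ (by omega) (by omega), if_neg (by omega), if_neg (by omega)]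
        · exact (congrArg _ (q.WWbig _ _ _ _ (by omega) (by omega) (by omega))).trans (map_zero _)
      rw [add_mul, add_mul, map_add, map_add, h1, h1, h1]; simp
    · rw [if_neg (by simp)]
      simp only [zd, Sum.elim_inr]
      have h1 : q.ψ (q.et ^ (s - 1 - t) * q.rep (.inl j')) = 0 := by
        fin_cases j'
        · exact (congrArg _ (q.etpe1 _ (by omega))).trans (map_zero _)
        · exact (congrArg _ (q.etpe2 _ (by omega))).trans (q.psi_etp _ (by omega) (by omega))
        · exact q.psi_etW _ _ _ (by omega) (by omega)
        · exact q.psi_etW _ _ _ (by omega) (by omega)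
      have h2 : q.ψ (q.W (3 * k - 2) 0 * q.rep (.inl j')) = 0 := by
        fin_cases j'
        · exact q.psi_We1z _ _ (by omega) (by omega)
        · exact q.psi_We2z _ _ (by omega) (by omega)
        · show q.ψ (_ * q.W 1 0) = 0
          rw [psi_WW _ _ _ _ _ (by omega) (by omega), if_neg (by omega), if_neg (by omega)]
        · exact (congrArg _ (q.WWbig _ _ _ _ (by omega) (by omega) (by omega))).trans (map_zero _)
      rw [add_mul, map_add, h1]
      split_ifs
      · rw [h2, add_zero]
      · simp
  · have hv : q.rep (.inr (.inl ⟨m', hm'⟩)) = q.W (3 * (m' + 1)) 0 := rfl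
    rw [hv]
    rcases j with j | ⟨m, hm⟩ | ⟨t, ht⟩
    · rw [if_neg (by simp)]
      have h1 : q.W (3 * k) 0 * q.W (3 * (m' + 1)) 0 = 0 := q.WWbig _ _ _ _ (by omega) (by omega) (by omega)
      have h2 : q.et ^ s * q.W (3 * (m' + 1)) 0 = 0 := q.etpW _ _ _ (by omega) (by omega) (by omega)
      have h3 : q.W (3 * k - 1) 1 * q.W (3 * (m' + 1)) 0 = 0 := q.WWbig _ _ _ _ (by omega) (by omega) (by omega)
      have h4 := q.psi_W (3 * (m' + 1)) 0 (by omega) (by omega)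
      fin_cases j <;> simp [zd, sub_mul, h1, h2, h3, h4]
    · simp only [zd, Sum.elim_inr, Sum.elim_inl]
      rw [add_mul, add_mul, map_add, map_add]
      simp only [psi_WW q _ _ _ _ (show 1 ≤ 3 * (k - 1 - m) by omega) (show 1 ≤ 3 * (m' + 1) by omega), c3, add_zero]
      have e1 : ¬ (0 : ZMod 3) = 1 := by decide
      have e2 : ¬ (0 : ZMod 3) = 2 := by decide
      have e3 : ¬ (3 * (k - 1 - m) = 1) := by omega
      simp only [e1, e2, e3, false_and, if_false, add_zero, true_and]
      congr 1
      simp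
      omega
    · rw [if_neg (by simp)]
      simp only [zd, Sum.elim_inr]
      rw [add_mul, map_add, psi_etW _ _ _ _ (by omega) (by omega)]
      split_ifs
      · rw [psi_WW _ _ _ _ _ (by omega) (by omega), if_neg (by omega), if_neg (by omega), add_zero]
      · simp
  · have hv : q.rep (.inr (.inr ⟨t', ht'⟩)) = q.et ^ (t' + 1) := rfl
    rw [hv]
    rcases j with j | ⟨m, hm⟩ | ⟨t, ht⟩
    · rw [if_neg (by simp)]
      have h1 : q.W (3 * k) 0 * q.et ^ (t' + 1) = 0 := q.Wetp _ _ _ (by omega) (by omega) (by omega)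
      have h2 : q.et ^ s * q.et ^ (t' + 1) = 0 := by rw [← pow_add, et_big _ _ (by omega)]
      have h3 := q.psi_Wet (t' + 1) (3 * k - 1) 1 (by omega) (by omega)
      have h4 := q.psi_etp (t' + 1) (by omega) (by omega)
      fin_cases j <;> simp [zd, sub_mul, h1, h2, h3, h4]
    · rw [if_neg (by simp)]
      simp only [zd, Sum.elim_inr, Sum.elim_inl]
      rw [add_mul, add_mul, map_add, map_add]
      simp only [psi_Wet q _ _ _ (show 1 ≤ t' + 1 by omega) (show 1 ≤ 3 * (k - 1 - m) by omega), add_zero]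
    · simp only [zd, Sum.elim_inr]
      rw [add_mul, map_add, ← pow_add, psi_etp' _ _ (by omega)]
      have h3 : q.ψ ((if t = s - 2 then q.W (3 * k - 2) 0 else 0) * q.et ^ (t' + 1)) = 0 := by
        split_ifs
        · rw [psi_Wet _ _ _ _ (by omega) (by omega)]
        · simp
      rw [h3, add_zero]
      congr 1
      simp
      omega

theorem expand (x : A) : x - ∑ j, q.ψ (q.zd j * x) • q.rep j ∈ cm K A := by
  have hx : x ∈ cm K A ⊔ Submodule.span K (Set.range q.rep) := by rw [rep_top]; trivial
  obtain ⟨y, hy, z, hz, rfl⟩ := Submodule.mem_sup.1 hx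
  obtain ⟨f, rfl⟩ := (Submodule.mem_span_range_iff_exists_fun K).1 hz
  have : ∀ j, q.ψ (q.zd j * (y + ∑ i, f i • q.rep i)) = f j := by
    intro j
    rw [mul_add, map_add, psi_cm _ _ _ hy, zero_add, Finset.mul_sum, map_sum]
    simp [zr]
  simp only [this]
  simpa using hy

theorem mem_cm (x : A) : x ∈ cm K A ↔ ∀ j, q.ψ (q.zd j * x) = 0 := by
  constructor
  · intro h j; exact q.psi_cm j x h
  · intro h
    have := q.expand x
    simpa [h] using this

end QA

/-- squaring on indices -/
def sg (k s : ℕ) : Fin 4 ⊕ (Fin (k - 1) ⊕ Fin (s - 1)) → Option (Fin 4 ⊕ (Fin (k - 1) ⊕ Fin (s - 1))) :=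
  Sum.elim ![some (.inl 0), some (.inl 1), some (.inl 3), none]
    (Sum.elim (fun m => if h : 2 * ((m : ℕ) + 1) < k then some (.inr (.inl ⟨2 * ((m : ℕ) + 1) - 1, by omega⟩)) else none)
      (fun t => if h : 2 * ((t : ℕ) + 1) < s then some (.inr (.inr ⟨2 * ((t : ℕ) + 1) - 1, by omega⟩)) else
        if 2 * ((t : ℕ) + 1) = s then some (.inl 3) else none))

/-- base indices -/
def Base (k s : ℕ) (j : Fin 4 ⊕ (Fin (k - 1) ⊕ Fin (s - 1))) : Prop := ∃ i, i ≠ .inl 3 ∧ sg k s j = some i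

theorem sg_inj (k s : ℕ) (i j j') (hi : i ≠ .inl 3) (h : sg k s j = some i) (h' : sg k s j' = some i) : j = j' := by
  rcases j with j | ⟨m, hm⟩ | ⟨t, ht⟩ <;> rcases j' with j' | ⟨m', hm'⟩ | ⟨t', ht'⟩
  · fin_cases j <;> fin_cases j' <;> simp_all [sg]
  · fin_cases j <;> simp [sg] at h h' <;> simp_all <;> grind
  · fin_cases j <;> simp [sg] at h h' <;> split_ifs at h' <;> simp_all <;> grind
  · fin_cases j' <;> simp [sg] at h h' <;> simp_all <;> grind
  · simp only [sg, Sum.elim_inr, Sum.elim_inl] at h h'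
    split_ifs at h h'
    rw [← h] at h'
    simp at h' ⊢; omega
  · simp only [sg, Sum.elim_inr, Sum.elim_inl] at h h'
    split_ifs at h h' <;> rw [← h] at h' <;> simp at h'
  · fin_cases j' <;> simp [sg] at h h' <;> split_ifs at h <;> simp_all <;> grind
  · simp only [sg, Sum.elim_inr, Sum.elim_inl] at h h'
    split_ifs at h h' <;> rw [← h] at h' <;> simp at h'
  · simp only [sg, Sum.elim_inr, Sum.elim_inl] at h h'
    split_ifs at h h' <;> rw [← h] at h' <;> simp at h' ⊢
    · omega
    · omega


namespace QA
variable {K A : Type} [Field K] [Ring A] [Algebra K A] {k s : ℕ} {a c : K}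
  (q : QA K A k s a c)

theorem rep_sq (hkodd : Odd k) (j) :
    q.rep j ^ 2 - (sg k s j).elim 0 (fun i => (if j = .inl 2 then c else 1) • q.rep i) ∈ cm K A := by
  have hk := q.hk
  have hs := q.hs
  obtain ⟨n, hn⟩ := hkodd
  rcases j with j | ⟨m, hm⟩ | ⟨t, ht⟩
  · fin_cases j
    · simp [rep, sg, pow_two, q.e11]
    · simp [rep, sg, pow_two, q.e22]
    · have h : q.W 1 0 ^ 2 = a • q.W (3 * k - 1) 1 + c • q.W (3 * k) 0 := by
        rw [W_one, l0, pow_two, alal', q.W_3k_al.2]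
      have h2 : q.W (3 * k - 1) 1 ∈ cm K A :=
        q.W_cm _ _ (by omega) (by rw [c31 _ (by omega)]; decide)
      have : q.W 1 0 ^ 2 - c • q.W (3 * k) 0 ∈ cm K A := by
        rw [h, add_sub_cancel_right]; exact Submodule.smul_mem _ _ h2
      simpa [rep, sg] using this
    · have h : q.W (3 * k) 0 ^ 2 = 0 := by
        rw [pow_two]; exact q.WWbig _ _ _ _ (by omega) (by omega) (by omega)
      simp [rep, sg, h]
  · have h : q.W (3 * (m + 1)) 0 ^ 2 = q.W (3 * (2 * (m + 1))) 0 := by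
      rw [pow_two, W_mul _ _ _ _ _ (by rw [c3, add_zero])]; congr 1; omega
    simp only [rep, sg, Sum.elim_inr, Sum.elim_inl, reduceCtorEq, if_false]
    rw [h]
    split_ifs with h1
    · simp only [Option.elim_some, one_smul, Sum.elim_inr, Sum.elim_inl]
      rw [show 2 * (m + 1) - 1 + 1 = 2 * (m + 1) by omega, sub_self]; exact zero_mem _
    · rw [W_big _ _ _ (by omega)]; simp
  · have h : (q.et ^ (t + 1)) ^ 2 = q.et ^ (2 * (t + 1)) := by
      rw [← pow_mul]; congr 1; omega
    simp only [rep, sg, Sum.elim_inr, reduceCtorEq, if_false]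
    rw [h]
    split_ifs with h1 h2
    · simp only [Option.elim_some, one_smul, Sum.elim_inr]
      rw [show 2 * (t + 1) - 1 + 1 = 2 * (t + 1) by omega, sub_self]; exact zero_mem _
    · rw [h2]
      simpa using q.ST_cm
    · rw [et_big _ _ (by omega)]; simp

theorem coef_sq [CharP K 2] (hkodd : Odd k) (x : A) (i) : q.ψ (q.zd i * x ^ 2) =
    ∑ j, q.ψ (q.zd j * x) ^ 2 * if sg k s j = some i then (if j = .inl 2 then c else 1) else 0 := by
  have h1 : x ^ 2 - ∑ j, (q.ψ (q.zd j * x) • q.rep j) ^ 2 ∈ cm K A := by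
    have e1 := q.expand x
    have e2 := sq_cm _ e1
    have e3 := sq_sum (K := K) Finset.univ (fun j => q.ψ (q.zd j * x) • q.rep j)
    have e4 := sq_add (K := K) (x - ∑ j, q.ψ (q.zd j * x) • q.rep j) (∑ j, q.ψ (q.zd j * x) • q.rep j)
    rw [sub_add_cancel] at e4
    have := add_mem (add_mem e2 e3) e4
    convert this using 1
    abel
  have h2 := q.psi_cm i _ h1
  rw [mul_sub, map_sub, sub_eq_zero, Finset.mul_sum, map_sum] at h2
  rw [h2]
  refine Finset.sum_congr rfl fun j _ => ?_
  have h3 := q.psi_cm i _ (q.rep_sq hkodd j)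
  rw [mul_sub, map_sub, sub_eq_zero] at h3
  rw [smul_pow, mul_smul_comm, map_smul, h3, smul_eq_mul]
  congr 1
  cases hj : sg k s j with
  | none => simp
  | some i' =>
    simp only [Option.elim_some, mul_smul_comm, map_smul, zr, smul_eq_mul, Option.some.injEq]
    by_cases h : i = i'
    · simp [h]
    · simp [h, Ne.symm h]

theorem T1_iff [CharP K 2] (hkodd : Odd k) (x : A) : x ^ 2 ∈ cm K A ↔
    (∀ j, Base k s j → q.ψ (q.zd j * x) = 0) ∧
    c * q.ψ (q.zd (.inl 2) * x) ^ 2 + ∑ t : Fin (s - 1),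
      (if 2 * ((t : ℕ) + 1) = s then q.ψ (q.zd (.inr (.inr t)) * x) ^ 2 else 0) = 0 := by
  have h3 : q.ψ (q.zd (.inl 3) * x ^ 2) = c * q.ψ (q.zd (.inl 2) * x) ^ 2 + ∑ t : Fin (s - 1),
      (if 2 * ((t : ℕ) + 1) = s then q.ψ (q.zd (.inr (.inr t)) * x) ^ 2 else 0) := by
    rw [q.coef_sq hkodd, Fintype.sum_sum_type, Fintype.sum_sum_type]
    congr 1
    · simp [Fin.sum_univ_four, sg, mul_comm]
    · have z1 : ∀ m : Fin (k - 1), sg k s (.inr (.inl m)) ≠ some (.inl 3) := by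
        intro m; simp only [sg, Sum.elim_inr, Sum.elim_inl]; split_ifs <;> simp
      have z2 : ∀ t : Fin (s - 1), sg k s (.inr (.inr t)) = some (.inl 3) ↔ 2 * ((t : ℕ) + 1) = s := by
        intro t; simp only [sg, Sum.elim_inr]; split_ifs <;> simp <;> omega
      simp only [z1, z2, if_false, mul_zero, Finset.sum_const_zero, zero_add]
      refine Finset.sum_congr rfl fun t _ => ?_
      simp
  rw [← h3, q.mem_cm]
  constructor
  · intro h
    refine ⟨?_, h _⟩
    rintro j ⟨i, hi, hj⟩
    have := h i
    rw [q.coef_sq hkodd, Finset.sum_eq_single j] at this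
    · have hj2 : j ≠ .inl 2 := by
        rintro rfl
        apply hi
        simpa [sg] using hj.symm
      simpa [hj, hj2] using this
    · intro j' _ hj'
      rw [if_neg, mul_zero]
      intro h'
      exact hj' (sg_inj k s i _ _ hi h' hj)
    · simp
  · rintro ⟨h1, h2⟩ i
    by_cases hi : i = .inl 3
    · rw [hi, h2]
    · rw [q.coef_sq hkodd]
      refine Finset.sum_eq_zero fun j _ => ?_
      split_ifs with h4
      · rw [h1 j ⟨i, hi, h4⟩]; simp
      · rw [h1 j ⟨i, hi, h4⟩]; simp
      · simp

theorem dimP {ι : Type} [Fintype ι] (z y : ι → A) (P : Submodule K A)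
    (hzy : ∀ i j, (i = j → q.ψ (z i * y j) = 1) ∧ (i ≠ j → q.ψ (z i * y j) = 0))
    (hP : ∀ x, x ∈ P ↔ ∀ m : A, m ^ 2 ∈ cm K A → q.ψ (x * m) = 0)
    (hT : ∀ m : A, m ^ 2 ∈ cm K A ↔ ∀ i, q.ψ (z i * m) = 0) :
    Module.finrank K P = Fintype.card ι := by
  classical
  have hli : LinearIndependent K z := by
    rw [Fintype.linearIndependent_iff]
    intro g hg i
    have := congrArg (fun x => q.ψ (x * y i)) hg
    simp only [Finset.sum_mul, map_sum, zero_mul, map_zero, smul_mul_assoc, map_smul, smul_eq_mul] at this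
    rw [Finset.sum_eq_single i] at this
    · simpa [(hzy i i).1 rfl] using this
    · intro j _ hj
      rw [(hzy j i).2 hj, mul_zero]
    · simp
  have hs : P = Submodule.span K (Set.range z) := by
    let F : A →ₗ[K] (A →ₗ[K] K) := LinearMap.mk₂ K (fun x m => q.ψ (x * m))
      (by intros; simp [add_mul]) (by intros; simp) (by intros; simp [mul_add]) (by intros; simp)
    apply le_antisymm
    · intro x hx
      rw [hP] at hx
      have h1 : F x ∈ Submodule.span K (Set.range (fun i => F (z i))) := by
        apply mem_span_of_iInf_ker_le_ker
        intro m hm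
        simp only [Submodule.mem_iInf, LinearMap.mem_ker] at hm ⊢
        exact hx m ((hT m).2 hm)
      obtain ⟨g, hg⟩ := (Submodule.mem_span_range_iff_exists_fun K).1 h1
      have h2 : x - ∑ i, g i • z i = 0 := by
        apply q.nondeg
        intro m
        have := congrArg (fun f => f m) hg
        simp only [LinearMap.coe_sum, Finset.sum_apply, LinearMap.smul_apply, F, LinearMap.mk₂_apply] at this
        rw [sub_mul, map_sub, ← this, Finset.sum_mul, map_sum, sub_eq_zero]
        simp
      rw [sub_eq_zero.1 h2]
      exact Submodule.sum_mem _ fun i _ => Submodule.smul_mem _ _ (Submodule.subset_span ⟨i, rfl⟩)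
    · rw [Submodule.span_le]
      rintro _ ⟨i, rfl⟩
      rw [SetLike.mem_coe, hP]
      intro m hm
      exact (hT m).1 hm i
  rw [hs, finrank_span_eq_card hli]

theorem dimE [CharP K 2] (hkodd : Odd k) {E : Type} [Fintype E] (z y : E → A) (P : Submodule K A)
    (hP : ∀ x, x ∈ P ↔ ∀ m : A, m ^ 2 ∈ cm K A → q.ψ (x * m) = 0)
    (hzy : ∀ i j, (i = j → q.ψ (z i * y j) = 1) ∧ (i ≠ j → q.ψ (z i * y j) = 0))
    (h1 : ∀ j e, Base k s j → q.ψ (q.zd j * y e) = 0)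
    (h2 : ∀ j e, Base k s j → q.ψ (z e * q.rep j) = 0)
    (h3 : ∀ x, (c * q.ψ (q.zd (.inl 2) * x) ^ 2 + ∑ t : Fin (s - 1),
      (if 2 * ((t : ℕ) + 1) = s then q.ψ (q.zd (.inr (.inr t)) * x) ^ 2 else 0) = 0) ↔
        ∀ e, q.ψ (z e * x) = 0) :
    Module.finrank K P = Nat.card {j // Base k s j} + Fintype.card E := by
  classical
  rw [Nat.card_eq_fintype_card, ← Fintype.card_sum]
  apply q.dimP (Sum.elim (fun j : {j // Base k s j} => q.zd j.1) z)
    (Sum.elim (fun j : {j // Base k s j} => q.rep j.1) y) P _ hP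
  · intro m
    rw [q.T1_iff hkodd, h3]
    simp
  · rintro (⟨i, hi⟩ | i) (⟨j, hj⟩ | j)
    · simp only [Sum.elim_inl, zr]
      constructor
      · intro h; simp at h; simp [h]
      · intro h; simp at h; simp [h]
    · simpa using h1 _ _ hi
    · simpa using h2 _ _ hj
    · simpa using hzy i j

theorem nb2 : ¬ Base k s (.inl 2) := by
  rintro ⟨i, hi, h⟩
  apply hi; simpa [sg] using h.symm

theorem nbh (t : Fin (s - 1)) (ht : 2 * ((t : ℕ) + 1) = s) : ¬ Base k s (.inr (.inr t)) := by
  rintro ⟨i, hi, h⟩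
  apply hi
  simp only [sg, Sum.elim_inr] at h
  rw [dif_neg (by omega), if_pos ht] at h
  simpa using h.symm

theorem sumOdd (hodd : Odd s) (f : Fin (s - 1) → K) :
    ∑ t : Fin (s - 1), (if 2 * ((t : ℕ) + 1) = s then f t else 0) = 0 := by
  obtain ⟨n, hn⟩ := hodd
  exact Finset.sum_eq_zero fun t _ => if_neg (by omega)

theorem sumEven (h : Fin (s - 1)) (hh : 2 * ((h : ℕ) + 1) = s) (f : Fin (s - 1) → K) :
    ∑ t : Fin (s - 1), (if 2 * ((t : ℕ) + 1) = s then f t else 0) = f h := by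
  rw [Finset.sum_eq_single h, if_pos hh]
  · intro t _ ht
    rw [if_neg]
    intro h'
    apply ht; ext; omega
  · simp


theorem zr0 {j j'} (h : j ≠ j') : q.ψ (q.zd j * q.rep j') = 0 := by rw [zr, if_neg h]
theorem zr1 (j) : q.ψ (q.zd j * q.rep j) = 1 := by rw [zr, if_pos rfl]
theorem bne {j j'} (h : Base k s j) (h' : ¬ Base k s j') : j ≠ j' := fun e => h' (e ▸ h)

theorem dim_odd0 [CharP K 2] (hkodd : Odd k) (P : Submodule K A)
    (hP : ∀ x, x ∈ P ↔ ∀ m : A, m ^ 2 ∈ cm K A → q.ψ (x * m) = 0) (hodd : Odd s) (hc : c = 0) : Module.finrank K P = Nat.card {j // Base k s j} := by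
  refine q.dimE hkodd (E := Empty) Empty.elim Empty.elim P hP (by simp) (by simp) (by simp) ?_
  intro x
  rw [sumOdd hodd]; simp [hc]

theorem dim_odd1 [CharP K 2] (hkodd : Odd k) (P : Submodule K A)
    (hP : ∀ x, x ∈ P ↔ ∀ m : A, m ^ 2 ∈ cm K A → q.ψ (x * m) = 0) (hodd : Odd s) (hc : c ≠ 0) : Module.finrank K P = Nat.card {j // Base k s j} + 1 := by
  refine q.dimE hkodd (E := Unit) (fun _ => q.zd (.inl 2)) (fun _ => q.rep (.inl 2)) P hP ?_ ?_ ?_ ?_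
  · simp [zr1]
  · intro j _ hj; exact q.zr0 (bne hj nb2)
  · intro j _ hj; exact q.zr0 (bne hj nb2).symm
  · intro x
    rw [sumOdd hodd]; simp [hc]

theorem dim_even0 [CharP K 2] (hkodd : Odd k) (P : Submodule K A)
    (hP : ∀ x, x ∈ P ↔ ∀ m : A, m ^ 2 ∈ cm K A → q.ψ (x * m) = 0) (heven : Even s) (hc : c = 0) : Module.finrank K P = Nat.card {j // Base k s j} + 1 := by
  have hs := q.hs
  obtain ⟨n, hn⟩ := heven
  obtain ⟨h, hh⟩ : ∃ h : Fin (s - 1), 2 * ((h : ℕ) + 1) = s := ⟨⟨n - 1, by omega⟩, by simp only; omega⟩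
  refine q.dimE hkodd (E := Unit) (fun _ => q.zd (.inr (.inr h))) (fun _ => q.rep (.inr (.inr h))) P hP ?_ ?_ ?_ ?_
  · simp [zr1]
  · intro j _ hj; exact q.zr0 (bne hj (nbh h hh))
  · intro j _ hj; exact q.zr0 (bne hj (nbh h hh)).symm
  · intro x
    rw [sumEven h hh]; simp [hc]

theorem dim_even_sq [CharP K 2] (hkodd : Odd k) (P : Submodule K A)
    (hP : ∀ x, x ∈ P ↔ ∀ m : A, m ^ 2 ∈ cm K A → q.ψ (x * m) = 0) (heven : Even s) (hc : IsSquare c) : Module.finrank K P = Nat.card {j // Base k s j} + 1 := by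
  have hs := q.hs
  obtain ⟨n, hn⟩ := heven
  obtain ⟨r, hr⟩ := hc
  obtain ⟨h, hh⟩ : ∃ h : Fin (s - 1), 2 * ((h : ℕ) + 1) = s := ⟨⟨n - 1, by omega⟩, by simp only; omega⟩
  refine q.dimE hkodd (E := Unit) (fun _ => q.zd (.inr (.inr h)) + r • q.zd (.inl 2))
    (fun _ => q.rep (.inr (.inr h))) P hP ?_ ?_ ?_ ?_
  · intro _ _
    simp [add_mul, zr]
  · intro j _ hj; exact q.zr0 (bne hj (nbh h hh))
  · intro j _ hj
    rw [add_mul, map_add, smul_mul_assoc, map_smul, q.zr0 (bne hj (nbh h hh)).symm, q.zr0 (bne hj nb2).symm]; simp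
  · intro x
    rw [sumEven h hh]
    have : c * q.ψ (q.zd (.inl 2) * x) ^ 2 + q.ψ (q.zd (.inr (.inr h)) * x) ^ 2 =
      (q.ψ ((q.zd (.inr (.inr h)) + r • q.zd (.inl 2)) * x)) ^ 2 := by
      rw [add_mul, map_add, smul_mul_assoc, map_smul, CharTwo.add_sq, smul_eq_mul]; linear_combination q.ψ (q.zd (.inl 2) * x) ^ 2 * hr
    rw [this]; simp

theorem dim_even_nsq [CharP K 2] (hkodd : Odd k) (P : Submodule K A)
    (hP : ∀ x, x ∈ P ↔ ∀ m : A, m ^ 2 ∈ cm K A → q.ψ (x * m) = 0) (heven : Even s) (hc : ¬ IsSquare c) : Module.finrank K P = Nat.card {j // Base k s j} + 2 := by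
  have hs := q.hs
  obtain ⟨n, hn⟩ := heven
  obtain ⟨h, hh⟩ : ∃ h : Fin (s - 1), 2 * ((h : ℕ) + 1) = s := ⟨⟨n - 1, by omega⟩, by simp only; omega⟩
  refine q.dimE hkodd (E := Bool) (fun b => if b then q.zd (.inr (.inr h)) else q.zd (.inl 2))
    (fun b => if b then q.rep (.inr (.inr h)) else q.rep (.inl 2)) P hP ?_ ?_ ?_ ?_
  · intro i j
    cases i <;> cases j <;> simp [zr]
  · intro j b hj
    cases b
    · exact q.zr0 (bne hj nb2)
    · exact q.zr0 (bne hj (nbh h hh))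
  · intro j b hj
    cases b
    · exact q.zr0 (bne hj nb2).symm
    · exact q.zr0 (bne hj (nbh h hh)).symm
  · intro x
    rw [sumEven h hh]
    simp only [Bool.forall_bool, if_true, Bool.false_eq_true, if_false]
    set u := q.ψ (q.zd (.inl 2) * x)
    set v := q.ψ (q.zd (.inr (.inr h)) * x)
    constructor
    · intro h0
      have hu : u = 0 := by
        by_contra hu
        apply hc
        refine ⟨v / u, ?_⟩
        have : c * u ^ 2 = v ^ 2 := CharTwo.add_eq_zero.1 h0
        field_simp
        exact this
      refine ⟨hu, ?_⟩
      simpa [hu] using h0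
    · rintro ⟨h1, h2⟩
      simp [h1, h2]

end QA

section wl
variable {A : Type} [Ring A] (al be ga : A)

theorem w_add (L M : ℕ) (i : ZMod 3) : w al be ga (L + M) i = w al be ga L i * w al be ga M (i + L) := by
  induction L generalizing i with
  | zero => simp [w]
  | succ n ih =>
    rw [show n + 1 + M = (n + M) + 1 by ring, w, ih, w, mul_assoc]
    push_cast
    rw [show i + 1 + (n : ZMod 3) = i + (n + 1) by ring]

theorem lt0 : lt al be ga 0 = al := by simp [lt]
theorem lt1 : lt al be ga 1 = be := by simp [lt]
theorem lt2 : lt al be ga 2 = ga := by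
  have h1 : (2 : ZMod 3) ≠ 0 := by decide
  have h2 : (2 : ZMod 3) ≠ 1 := by decide
  simp [lt, h1, h2]
theorem w1 (i) : w al be ga 1 i = lt al be ga i := by simp [w]
theorem w2 (i) : w al be ga 2 i = lt al be ga i * lt al be ga (i + 1) := by simp [w]
theorem w3 (i) : w al be ga 3 i = lt al be ga i * lt al be ga (i + 1) * lt al be ga (i + 1 + 1) := by
  simp [w, mul_assoc]
theorem w3n (n : ℕ) (i : ZMod 3) : w al be ga (3 * n) i = w al be ga 3 i ^ n := by
  induction n with
  | zero => simp [w]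
  | succ n ih =>
    rw [mul_add, mul_one, w_add, ih, pow_succ, QA.c3, add_zero]
theorem z12 : (1 : ZMod 3) + 1 = 2 := by decide
theorem z21 : (2 : ZMod 3) + 1 = 0 := by decide
theorem w30 (n : ℕ) : w al be ga (3 * n) 0 = (al * be * ga) ^ n := by
  rw [w3n, w3, zero_add, z12, lt0, lt1, lt2]
theorem w31 (n : ℕ) : w al be ga (3 * n) 1 = (be * ga * al) ^ n := by
  rw [w3n, w3, z12, z21, lt0, lt1, lt2]
theorem w32 (n : ℕ) : w al be ga (3 * n) 2 = (ga * al * be) ^ n := by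
  rw [w3n, w3, z21, zero_add, lt0, lt1, lt2]
theorem w20 (n : ℕ) : w al be ga (3 * n + 2) 0 = (al * be * ga) ^ n * (al * be) := by
  rw [w_add, w30, QA.c3, add_zero, w2, zero_add, lt0, lt1]
theorem w21 (n : ℕ) : w al be ga (3 * n + 2) 1 = (be * ga * al) ^ n * (be * ga) := by
  rw [w_add, w31, QA.c3, add_zero, w2, z12, lt1, lt2]
theorem w22 (n : ℕ) : w al be ga (3 * n + 2) 2 = (ga * al * be) ^ n * (ga * al) := by
  rw [w_add, w32, QA.c3, add_zero, w2, z21, lt0, lt2]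
theorem w10 (n : ℕ) : w al be ga (3 * n + 1) 0 = al * (be * ga * al) ^ n := by
  rw [add_comm, w_add, w1, lt0, Nat.cast_one, zero_add, w31]
theorem w11 (n : ℕ) : w al be ga (3 * n + 1) 1 = (be * ga * al) ^ n * be := by
  rw [w_add, w31, QA.c3, add_zero, w1, lt1]
theorem w12 (n : ℕ) : w al be ga (3 * n + 1) 2 = (ga * al * be) ^ n * ga := by
  rw [w_add, w32, QA.c3, add_zero, w1, lt2]
theorem w20' (n : ℕ) : w al be ga (3 * n + 2) 0 = al * (be * ga * al) ^ n * be := by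
  rw [show 3 * n + 2 = 3 * n + 1 + 1 by ring, w_add, w10, w1, Nat.cast_add, QA.c3, zero_add, zero_add,
    Nat.cast_one, lt1]
end wl

section inst
open QT
variable (K : Type) [Field K] (k s : ℕ) (a c : K)

theorem Aa_top (M : Submodule K (Aa K k s a c)) (h1 : 1 ∈ M) (he : ∀ x ∈ M, E1 K k s a c * x ∈ M)
    (ha : ∀ x ∈ M, Al K k s a c * x ∈ M) (hb : ∀ x ∈ M, Be K k s a c * x ∈ M)
    (hg : ∀ x ∈ M, Ga K k s a c * x ∈ M) (ht : ∀ x ∈ M, Et K k s a c * x ∈ M)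
    (hsum : E1 K k s a c + E2 K k s a c = 1) : M = ⊤ := by
  have key : ∀ f : FreeAlgebra K Gen, ∀ x ∈ M, RingQuot.mkAlgHom K (Rel K k s a c) f * x ∈ M := by
    intro f
    induction f using FreeAlgebra.induction with
    | grade0 r =>
      intro x hx
      rw [AlgHom.commutes, ← Algebra.smul_def]
      exact M.smul_mem _ hx
    | grade1 g =>
      intro x hx
      cases g with
      | e1 => exact he x hx
      | e2 =>
        have h2 : E2 K k s a c = 1 - E1 K k s a c := by rw [← hsum]; abel
        have : E2 K k s a c * x ∈ M := by
          rw [h2, sub_mul, one_mul]; exact sub_mem hx (he x hx)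
        exact this
      | al => exact ha x hx
      | be => exact hb x hx
      | ga => exact hg x hx
      | et => exact ht x hx
    | mul f g hf hg =>
      intro x hx
      rw [map_mul, mul_assoc]; exact hf _ (hg _ hx)
    | add f g hf hg =>
      intro x hx
      rw [map_add, add_mul]; exact add_mem (hf _ hx) (hg _ hx)
  rw [eq_top_iff]
  intro y _
  obtain ⟨f, rfl⟩ := RingQuot.mkAlgHom_surjective K (Rel K k s a c) y
  simpa using key f 1 h1

theorem psiW (ψ : Aa K k s a c →ₗ[K] K) (hψ : IsPsi K k s a c ψ) (L : ℕ) (i : ZMod 3) (hL : 1 ≤ L) (hLk : L < 3 * k)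
    (h1 : w (Al K k s a c) (Be K k s a c) (Ga K k s a c) L i ≠ Et K k s a c ^ s)
    (h2 : w (Al K k s a c) (Be K k s a c) (Ga K k s a c) L i ≠
      w (Al K k s a c) (Be K k s a c) (Ga K k s a c) (3 * k) 0) :
    ψ (w (Al K k s a c) (Be K k s a c) (Ga K k s a c) L i) = 0 := by
  rw [w30] at h2
  have key : ∀ j, bVec K k s a c j = w (Al K k s a c) (Be K k s a c) (Ga K k s a c) L i →
      ψ (w (Al K k s a c) (Be K k s a c) (Ga K k s a c) L i) = 0 := by
    intro j hj
    rw [← hj] at h1 h2 ⊢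
    exact hψ.2.2 j h1 h2
  clear h1 h2
  obtain ⟨n, r, hr, rfl⟩ : ∃ n r, r < 3 ∧ L = 3 * n + r := ⟨L / 3, L % 3, by omega, by omega⟩
  obtain rfl | rfl | rfl : r = 0 ∨ r = 1 ∨ r = 2 := by omega
  · rw [add_zero] at *
    rcases QA.zc i with rfl | rfl | rfl
    · exact key (.inl (.inr (.inr ⟨n, by omega⟩))) (by rw [w30]; rfl)
    · refine key (.inl (.inr (.inl ⟨n - 1, by omega⟩))) ?_
      rw [w31]; simp only [bVec]; rw [show n - 1 + 1 = n by omega]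
    · refine key (.inr (.inl (.inr ⟨n - 1, by omega⟩))) ?_
      rw [w32]; simp only [bVec]; rw [show n - 1 + 1 = n by omega]
  · rcases QA.zc i with rfl | rfl | rfl
    · exact key (.inl (.inl (.inl ⟨n, by omega⟩))) (by rw [w10]; rfl)
    · exact key (.inr (.inr (.inl (.inl ⟨n, by omega⟩)))) (by rw [w11]; rfl)
    · exact key (.inr (.inr (.inr (.inl ⟨n, by omega⟩)))) (by rw [w12]; rfl)
  · rcases QA.zc i with rfl | rfl | rfl
    · exact key (.inr (.inr (.inl (.inr ⟨n, by omega⟩)))) (by rw [w20']; rfl)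
    · exact key (.inl (.inl (.inr ⟨n, by omega⟩))) (by rw [w21]; rfl)
    · exact key (.inr (.inr (.inr (.inr ⟨n, by omega⟩)))) (by rw [w22]; rfl)

/-- the algebra as an instance of the abstract data -/
noncomputable def mkQA (hk : 1 < k) (hs : 3 ≤ s) (ha : a ≠ 0) (ψ : Aa K k s a c →ₗ[K] K)
    (hψ : IsPsi K k s a c ψ) : QA K (Aa K k s a c) k s a c where
  e1 := E1 K k s a c
  e2 := E2 K k s a c
  al := Al K k s a c
  be := Be K k s a c
  ga := Ga K k s a c
  et := Et K k s a c
  ψ := ψ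
  hk := hk
  hs := hs
  ha := ha
  e11 := by simpa [E1, E2, Al, Be, Ga, Et] using RingQuot.mkAlgHom_rel K (Rel.idem1 (K := K) (k := k) (s := s) (a := a) (c := c))
  e22 := by simpa [E1, E2, Al, Be, Ga, Et] using RingQuot.mkAlgHom_rel K (Rel.idem2 (K := K) (k := k) (s := s) (a := a) (c := c))
  e12 := by simpa [E1, E2, Al, Be, Ga, Et] using RingQuot.mkAlgHom_rel K (Rel.orth12 (K := K) (k := k) (s := s) (a := a) (c := c))
  e21 := by simpa [E1, E2, Al, Be, Ga, Et] using RingQuot.mkAlgHom_rel K (Rel.orth21 (K := K) (k := k) (s := s) (a := a) (c := c))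
  esum := by simpa [E1, E2, Al, Be, Ga, Et] using RingQuot.mkAlgHom_rel K (Rel.sum_idem (K := K) (k := k) (s := s) (a := a) (c := c))
  e1al := by simpa [E1, E2, Al, Be, Ga, Et] using RingQuot.mkAlgHom_rel K (Rel.al_left (K := K) (k := k) (s := s) (a := a) (c := c))
  ale1 := by simpa [E1, E2, Al, Be, Ga, Et] using RingQuot.mkAlgHom_rel K (Rel.al_right (K := K) (k := k) (s := s) (a := a) (c := c))
  e1be := by simpa [E1, E2, Al, Be, Ga, Et] using RingQuot.mkAlgHom_rel K (Rel.be_left (K := K) (k := k) (s := s) (a := a) (c := c))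
  bee2 := by simpa [E1, E2, Al, Be, Ga, Et] using RingQuot.mkAlgHom_rel K (Rel.be_right (K := K) (k := k) (s := s) (a := a) (c := c))
  e2ga := by simpa [E1, E2, Al, Be, Ga, Et] using RingQuot.mkAlgHom_rel K (Rel.ga_left (K := K) (k := k) (s := s) (a := a) (c := c))
  gae1 := by simpa [E1, E2, Al, Be, Ga, Et] using RingQuot.mkAlgHom_rel K (Rel.ga_right (K := K) (k := k) (s := s) (a := a) (c := c))
  e2et := by simpa [E1, E2, Al, Be, Ga, Et] using RingQuot.mkAlgHom_rel K (Rel.et_left (K := K) (k := k) (s := s) (a := a) (c := c))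
  ete2 := by simpa [E1, E2, Al, Be, Ga, Et] using RingQuot.mkAlgHom_rel K (Rel.et_right (K := K) (k := k) (s := s) (a := a) (c := c))
  beet := by
    rw [show 3 * k - 1 = 3 * (k - 1) + 2 by omega, w20]
    simpa [E1, E2, Al, Be, Ga, Et] using RingQuot.mkAlgHom_rel K (Rel.rel_beta_eta (K := K) (k := k) (s := s) (a := a) (c := c))
  etga := by
    rw [show 3 * k - 1 = 3 * (k - 1) + 2 by omega, w22]
    simpa [E1, E2, Al, Be, Ga, Et] using RingQuot.mkAlgHom_rel K (Rel.rel_eta_gamma (K := K) (k := k) (s := s) (a := a) (c := c))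
  alal := by
    rw [show 3 * k - 1 = 3 * (k - 1) + 2 by omega, w21, w31]
    simpa [E1, E2, Al, Be, Ga, Et] using RingQuot.mkAlgHom_rel K (Rel.rel_alpha_sq (K := K) (k := k) (s := s) (a := a) (c := c))
  gabe := by simpa [E1, E2, Al, Be, Ga, Et] using RingQuot.mkAlgHom_rel K (Rel.rel_gamma_beta (K := K) (k := k) (s := s) (a := a) (c := c))
  alalbe := by
    simpa [E1, E2, Al, Be, Ga, Et] using RingQuot.mkAlgHom_rel K (Rel.rel_alpha_sq_beta (K := K) (k := k) (s := s) (a := a) (c := c))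
  gaalal := by
    simpa [E1, E2, Al, Be, Ga, Et] using RingQuot.mkAlgHom_rel K (Rel.rel_gamma_alpha_sq (K := K) (k := k) (s := s) (a := a) (c := c))
  top := fun M h1 he ha hb hg ht => Aa_top K k s a c M h1 he ha hb hg ht
    (by simpa [E1, E2, Al, Be, Ga, Et] using RingQuot.mkAlgHom_rel K (Rel.sum_idem (K := K) (k := k) (s := s) (a := a) (c := c)))
  psi_et := hψ.1
  psi_S := by rw [w30]; exact hψ.2.1
  psi_W0 := fun L i hL hLk h1 h2 => psiW K k s a c ψ hψ L i hL hLk h1 h2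
  psi_et0 := by
    intro n hn hns h1 h2
    rw [w30] at h2
    exact hψ.2.2 (.inr (.inl (.inl ⟨n, by omega⟩))) h1 h2

theorem mem_perp (hk : 1 < k) (hs : 3 ≤ s) (ha : a ≠ 0) (ψ : Aa K k s a c →ₗ[K] K)
    (hψ : IsPsi K k s a c ψ) (x : Aa K k s a c) : x ∈ perp K k s a c ψ ↔
      ∀ m : Aa K k s a c, m ^ 2 ∈ cm K (Aa K k s a c) → (mkQA K k s a c hk hs ha ψ hψ).ψ (x * m) = 0 := by
  simp only [perp, Submodule.mem_iInf, LinearMap.mem_ker, LinearMap.comp_apply, LinearMap.mulRight_apply]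
  exact Iff.rfl

end inst
end QP

open QT in
/-- char K = 2, k > 1 odd, s ≥ 3, a, c ≠ 0.
If s is even and c is a square in K, then dim T₁(A^{k,s}(a,c))^⊥ = dim T₁(A^{k,s}(a,0))^⊥.
If s is odd, or c is not a square in K, then
dim T₁(A^{k,s}(a,c))^⊥ = dim T₁(A^{k,s}(a,0))^⊥ + 1. -/
theorem statement11 (K : Type) [Field K] [CharP K 2] (k s : ℕ)
    (hk : 1 < k) (hkodd : Odd k) (hs : 3 ≤ s) (a c : K) (ha : a ≠ 0) (hc : c ≠ 0)
    (ψc : Aa K k s a c →ₗ[K] K) (hψc : IsPsi K k s a c ψc)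
    (ψ0 : Aa K k s a 0 →ₗ[K] K) (hψ0 : IsPsi K k s a 0 ψ0) :
    (Even s → IsSquare c →
      Module.finrank K (perp K k s a c ψc) = Module.finrank K (perp K k s a 0 ψ0)) ∧
    (Odd s ∨ ¬ IsSquare c →
      Module.finrank K (perp K k s a c ψc) = Module.finrank K (perp K k s a 0 ψ0) + 1) := by
  have hq := QP.mem_perp K k s a c hk hs ha ψc hψc
  have hq0 := QP.mem_perp K k s a 0 hk hs ha ψ0 hψ0
  constructor
  · intro he hsq
    rw [QP.QA.dim_even_sq _ hkodd _ hq he hsq, QP.QA.dim_even0 _ hkodd _ hq0 he rfl]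
  · intro h
    rcases Nat.even_or_odd s with he | ho
    · have hn : ¬ IsSquare c := by
        rcases h with h | h
        · exact absurd he (Nat.not_even_iff_odd.2 h)
        · exact h
      rw [QP.QA.dim_even_nsq _ hkodd _ hq he hn, QP.QA.dim_even0 _ hkodd _ hq0 he rfl]
    · rw [QP.QA.dim_odd1 _ hkodd _ hq ho hc, QP.QA.dim_odd0 _ hkodd _ hq0 ho rfl]
end
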